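/- Let ρ > 0 and let u be a 1-periodic function on ℝ³ with ∫_{[0,1]³} u dV = 0 which is C² with ρ-Hölder continuous second derivatives, and which solves the reduced Calabi–Yau equation (u_xx + 1)(u_yy + u_tt + u_t + 1) − u_xy² − u_xt² = e^F. If F is 1-periodic and C^∞, then u is C^∞. -/

import Mathlib

open MeasureTheory

noncomputable section

/-- Points of `ℝ³`, written as `ℝ × ℝ × ℝ`. -/
abbrev R3 := ℝ × ℝ × ℝ

/-- The coordinate direction `x`. -/
def vx : R3 := (1, 0, 0)
/-- The coordinate direction `y`. -/
def vy : R3 := (0, 1, 0)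
/-- The coordinate direction `t`. -/
def vt : R3 := (0, 0, 1)

/-- Partial (directional) derivative in the direction `e`. -/
def pd (e : R3) (u : R3 → ℝ) : R3 → ℝ := fun p => fderiv ℝ u p e

/-- `1`-periodicity in each of the three variables. -/
def Periodic3 (u : R3 → ℝ) : Prop :=
  ∀ p : R3, u (p + vx) = u p ∧ u (p + vy) = u p ∧ u (p + vt) = u p

/-- The unit cube `[0,1]³`. -/
def cube : Set R3 := Set.Icc (0, 0, 0) (1, 1, 1)

/-- Zero mean over the unit cube. -/
def ZeroMean (u : R3 → ℝ) : Prop := ∫ p in cube, u p = 0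

/-- The reduced Calabi–Yau equation
`(u_xx + 1)(u_yy + u_tt + u_t + 1) − u_xy² − u_xt² = e^F` on `ℝ³`. -/
def CYeq (F u : R3 → ℝ) : Prop :=
  ∀ p : R3,
    (pd vx (pd vx u) p + 1)
        * (pd vy (pd vy u) p + pd vt (pd vt u) p + pd vt u p + 1)
      - (pd vy (pd vx u) p) ^ 2 - (pd vt (pd vx u) p) ^ 2 = Real.exp (F p)

/-- The Euclidean norm on `ℝ³ = ℝ × ℝ × ℝ`. -/
def enorm3 (h : R3) : ℝ := Real.sqrt (h.1 ^ 2 + h.2.1 ^ 2 + h.2.2 ^ 2)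

/-! ### Averages of periodic functions -/

/-- The quotient map from `ℝ³` to the torus. -/
def toTorus (p : R3) : UnitAddTorus (Fin 3) := ![(p.1 : UnitAddCircle), p.2.1, p.2.2]

/-- A set-theoretic section of the quotient map. -/
def torusSec (θ : UnitAddTorus (Fin 3)) : R3 :=
  (Quotient.out (θ 0), Quotient.out (θ 1), Quotient.out (θ 2))

/-- The Haar probability measure on the torus. -/
def torusMeasure : Measure (UnitAddTorus (Fin 3)) :=
  Measure.pi (fun _ => AddCircle.haarAddCircle)

instance : IsProbabilityMeasure torusMeasure := by
  unfold torusMeasure; infer_instance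

instance : torusMeasure.IsAddRightInvariant := by
  unfold torusMeasure; infer_instance

/-- The average of a periodic function. -/
def avg (f : R3 → ℝ) : ℝ := ∫ θ, f (torusSec θ) ∂torusMeasure

lemma toTorus_add (p q : R3) : toTorus (p + q) = toTorus p + toTorus q := by
  ext i; fin_cases i <;> simp [toTorus]

lemma toTorus_torusSec (θ : UnitAddTorus (Fin 3)) : toTorus (torusSec θ) = θ := by
  ext i; fin_cases i <;> simp [toTorus, torusSec]

lemma Periodic3.comp_lattice {f : R3 → ℝ} (hf : Periodic3 f) (p : R3) (a b c : ℤ) :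
    f (p + ((a : ℝ), (b : ℝ), (c : ℝ))) = f p := by
  have hx : Function.Periodic f vx := fun p => (hf p).1
  have hy : Function.Periodic f vy := fun p => (hf p).2.1
  have ht : Function.Periodic f vt := fun p => (hf p).2.2
  have h : (p + ((a : ℝ), (b : ℝ), (c : ℝ)) : R3) = p + a • vx + b • vy + c • vt := by
    simp [vx, vy, vt, Prod.ext_iff]
  rw [h, ht.zsmul c, hy.zsmul b, hx.zsmul a]

lemma Periodic3.eq_of_toTorus_eq {f : R3 → ℝ} (hf : Periodic3 f) {p q : R3}
    (h : toTorus p = toTorus q) : f p = f q := by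
  have key : ∀ a b : ℝ, (a : UnitAddCircle) = b → ∃ n : ℤ, a = b + n := fun a b hab => by
    rw [← sub_eq_zero, ← AddCircle.coe_sub, AddCircle.coe_eq_zero_iff] at hab
    obtain ⟨n, hn⟩ := hab
    exact ⟨n, by simp at hn; linarith⟩
  obtain ⟨a, ha⟩ := key p.1 q.1 (by simpa [toTorus] using congrFun h 0)
  obtain ⟨b, hb⟩ := key p.2.1 q.2.1 (by simpa [toTorus] using congrFun h 1)
  obtain ⟨c, hc⟩ := key p.2.2 q.2.2 (by simpa [toTorus] using congrFun h 2)
  rw [← hf.comp_lattice q a b c]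
  congr 1
  ext <;> simp [ha, hb, hc]

lemma Periodic3.apply_torusSec {f : R3 → ℝ} (hf : Periodic3 f) (p : R3) :
    f (torusSec (toTorus p)) = f p :=
  hf.eq_of_toTorus_eq (toTorus_torusSec _)

lemma Periodic3.apply_torusSec_add {f : R3 → ℝ} (hf : Periodic3 f) (θ) (p : R3) :
    f (torusSec (θ + toTorus p)) = f (torusSec θ + p) :=
  hf.eq_of_toTorus_eq (by rw [toTorus_torusSec, toTorus_add, toTorus_torusSec])

/-- Continuous periodic functions. -/
structure PerCont (f : R3 → ℝ) : Prop where
  per : Periodic3 f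
  cont : Continuous f

lemma PerCont.continuous_torusSec {f : R3 → ℝ} (hf : PerCont f) :
    Continuous (fun θ => f (torusSec θ)) := by
  have hq : IsOpenQuotientMap (Pi.map (fun (_ : Fin 3) (x : ℝ) => (x : UnitAddCircle))) :=
    IsOpenQuotientMap.piMap fun _ => QuotientAddGroup.isOpenQuotientMap_mk
  rw [hq.isQuotientMap.continuous_iff]
  have : (fun θ => f (torusSec θ)) ∘ Pi.map (fun (_ : Fin 3) (x : ℝ) => (x : UnitAddCircle))
      = fun x => f (x 0, x 1, x 2) := by
    ext x
    refine hf.per.eq_of_toTorus_eq ?_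
    rw [toTorus_torusSec]
    ext i; fin_cases i <;> simp [toTorus]
  rw [this]
  exact hf.cont.comp (by fun_prop)

lemma PerCont.integrable {f : R3 → ℝ} (hf : PerCont f) :
    Integrable (fun θ => f (torusSec θ)) torusMeasure :=
  hf.continuous_torusSec.integrable_of_hasCompactSupport (HasCompactSupport.of_compactSpace _)

lemma PerCont.bounded {f : R3 → ℝ} (hf : PerCont f) : ∃ M, 0 ≤ M ∧ ∀ p, |f p| ≤ M := by
  obtain ⟨M, hM⟩ := isCompact_univ.exists_bound_of_continuousOn hf.continuous_torusSec.continuousOn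
  refine ⟨max M 0, le_max_right _ _, fun p => ?_⟩
  have := hM (toTorus p) trivial
  rw [hf.per.apply_torusSec, Real.norm_eq_abs] at this
  exact this.trans (le_max_left _ _)

lemma PerCont.lower_bound {f : R3 → ℝ} (hf : PerCont f) (hpos : ∀ p, 0 < f p) :
    ∃ l, 0 < l ∧ ∀ p, l ≤ f p := by
  obtain ⟨θ, -, h⟩ := isCompact_univ.exists_isMinOn Set.univ_nonempty
    hf.continuous_torusSec.continuousOn
  refine ⟨_, hpos (torusSec θ), fun p => ?_⟩
  have := h (Set.mem_univ (toTorus p))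
  simpa [hf.per.apply_torusSec] using this

section PerContClosure
variable {f g : R3 → ℝ}

lemma PerCont.const (c : ℝ) : PerCont (fun _ => c) :=
  ⟨fun _ => ⟨rfl, rfl, rfl⟩, continuous_const⟩

lemma PerCont.add (hf : PerCont f) (hg : PerCont g) : PerCont (fun p => f p + g p) :=
  ⟨fun p => by simp [hf.per p, hg.per p], hf.cont.add hg.cont⟩

lemma PerCont.sub (hf : PerCont f) (hg : PerCont g) : PerCont (fun p => f p - g p) :=
  ⟨fun p => by simp [hf.per p, hg.per p], hf.cont.sub hg.cont⟩

lemma PerCont.mul (hf : PerCont f) (hg : PerCont g) : PerCont (fun p => f p * g p) :=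
  ⟨fun p => by simp [hf.per p, hg.per p], hf.cont.mul hg.cont⟩

lemma PerCont.neg (hf : PerCont f) : PerCont (fun p => -f p) :=
  ⟨fun p => by simp [hf.per p], hf.cont.neg⟩

lemma PerCont.sq (hf : PerCont f) : PerCont (fun p => f p ^ 2) :=
  ⟨fun p => by simp [hf.per p], hf.cont.pow 2⟩

lemma PerCont.const_mul (c : ℝ) (hf : PerCont f) : PerCont (fun p => c * f p) :=
  (PerCont.const c).mul hf

lemma PerCont.shift (hf : PerCont f) (h : R3) : PerCont (fun p => f (p + h)) :=
  ⟨fun p => by simp only [add_right_comm p _ h, hf.per (p + h), and_self],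
    hf.cont.comp (by fun_prop)⟩

lemma avg_add (hf : PerCont f) (hg : PerCont g) : avg (fun p => f p + g p) = avg f + avg g :=
  integral_add hf.integrable hg.integrable

lemma avg_sub (hf : PerCont f) (hg : PerCont g) : avg (fun p => f p - g p) = avg f - avg g :=
  integral_sub hf.integrable hg.integrable

lemma avg_const_mul (c : ℝ) (f : R3 → ℝ) : avg (fun p => c * f p) = c * avg f :=
  integral_const_mul _ _

lemma avg_const (c : ℝ) : avg (fun _ => c) = c := by
  simp [avg]

lemma avg_mono (hf : PerCont f) (hg : PerCont g) (h : ∀ p, f p ≤ g p) : avg f ≤ avg g :=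
  integral_mono hf.integrable hg.integrable fun _ => h _

lemma avg_nonneg (h : ∀ p, 0 ≤ f p) : 0 ≤ avg f :=
  integral_nonneg fun _ => h _

lemma avg_shift (hf : Periodic3 f) (h : R3) : avg (fun p => f (p + h)) = avg f := by
  unfold avg
  simp_rw [← hf.apply_torusSec_add]
  exact integral_add_right_eq_self (fun θ => f (torusSec θ)) (toTorus h)

end PerContClosure
/-! ### Integration by parts -/

/-- Periodic functions of class `C^n`. -/
structure PerDiff (n : ℕ) (f : R3 → ℝ) : Prop where
  per : Periodic3 f
  diff : ContDiff ℝ n f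

lemma PerDiff.perCont {n : ℕ} {f : R3 → ℝ} (hf : PerDiff n f) : PerCont f :=
  ⟨hf.per, hf.diff.continuous⟩

lemma PerDiff.of_le {m n : ℕ} {f : R3 → ℝ} (hf : PerDiff n f) (h : m ≤ n) : PerDiff m f :=
  ⟨hf.per, hf.diff.of_le (by exact_mod_cast h)⟩

lemma PerDiff.differentiable {n : ℕ} {f : R3 → ℝ} (hf : PerDiff (n + 1) f) :
    Differentiable ℝ f := hf.diff.differentiable (by simp)

lemma pd_shift (e h : R3) (f : R3 → ℝ) (p : R3) :
    pd e (fun q => f (q + h)) p = pd e f (p + h) := by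
  simp [pd, fderiv_comp_add_right]

lemma Periodic3.pd {f : R3 → ℝ} (hf : Periodic3 f) (e : R3) : Periodic3 (pd e f) := by
  intro p
  have key : ∀ v, (∀ q, f (q + v) = f q) → _root_.pd e f (p + v) = _root_.pd e f p := fun v hv => by
    rw [← pd_shift, show (fun q => f (q + v)) = f from funext hv]
  exact ⟨key _ fun q => (hf q).1, key _ fun q => (hf q).2.1, key _ fun q => (hf q).2.2⟩

lemma PerDiff.pd {n : ℕ} {f : R3 → ℝ} (hf : PerDiff (n + 1) f) (e : R3) : PerDiff n (pd e f) := by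
  refine ⟨hf.per.pd e, ?_⟩
  have h := hf.diff
  push_cast at h
  exact (h.fderiv_right le_rfl).clm_apply contDiff_const

section PerDiffClosure
variable {n : ℕ} {f g : R3 → ℝ}

lemma PerDiff.const (c : ℝ) : PerDiff n (fun _ => c) :=
  ⟨fun _ => ⟨rfl, rfl, rfl⟩, contDiff_const⟩

lemma PerDiff.sub (hf : PerDiff n f) (hg : PerDiff n g) : PerDiff n (fun p => f p - g p) :=
  ⟨fun p => by simp [hf.per p, hg.per p], hf.diff.sub hg.diff⟩

lemma PerDiff.mul (hf : PerDiff n f) (hg : PerDiff n g) : PerDiff n (fun p => f p * g p) :=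
  ⟨fun p => by simp [hf.per p, hg.per p], hf.diff.mul hg.diff⟩

lemma PerDiff.shift (hf : PerDiff n f) (h : R3) : PerDiff n (fun p => f (p + h)) :=
  ⟨(hf.perCont.shift h).per, hf.diff.comp (by fun_prop)⟩

lemma pd_add (e : R3) (hf : Differentiable ℝ f) (hg : Differentiable ℝ g) (p : R3) :
    pd e (fun q => f q + g q) p = pd e f p + pd e g p := by
  simp [pd, fderiv_fun_add (hf p) (hg p)]

lemma pd_sub (e : R3) (hf : Differentiable ℝ f) (hg : Differentiable ℝ g) (p : R3) :
    pd e (fun q => f q - g q) p = pd e f p - pd e g p := by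
  simp [pd, fderiv_fun_sub (hf p) (hg p)]

lemma pd_mul (e : R3) (hf : Differentiable ℝ f) (hg : Differentiable ℝ g) (p : R3) :
    pd e (fun q => f q * g q) p = f p * pd e g p + g p * pd e f p := by
  simp [pd, fderiv_fun_mul (hf p) (hg p)]

lemma pd_comm {f : R3 → ℝ} (hf : ContDiff ℝ 2 f) (a b p : R3) :
    pd a (pd b f) p = pd b (pd a f) p := by
  have key : ∀ a b : R3, pd a (pd b f) p = fderiv ℝ (fderiv ℝ f) p a b := fun a b => by
    have hd : DifferentiableAt ℝ (fderiv ℝ f) p :=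
      (hf.fderiv_right (m := 1) (by norm_num)).differentiable (by simp) p
    unfold pd
    rw [fderiv_clm_apply hd (differentiableAt_const b)]
    simp
  rw [key, key]
  exact (hf.contDiffAt.isSymmSndFDerivAt (by simp)) a b

lemma hasDerivAt_line (hf : Differentiable ℝ f) (e p : R3) (s : ℝ) :
    HasDerivAt (fun r : ℝ => f (p + r • e)) (pd e f (p + s • e)) s := by
  have h1 : HasDerivAt (fun r : ℝ => p + r • e) e s := by
    simpa using ((hasDerivAt_id s).smul_const e).const_add p
  exact (hf (p + s • e)).hasFDerivAt.comp_hasDerivAt s h1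

lemma abs_sub_line_le (hf : Differentiable ℝ f) (e : R3) {M : ℝ} (hM : ∀ p, |pd e f p| ≤ M)
    (p : R3) (s : ℝ) : |f (p + s • e) - f p| ≤ M * |s| := by
  have := Convex.norm_image_sub_le_of_norm_hasDerivWithin_le (s := Set.univ) (x := 0) (y := s)
    (f := fun r : ℝ => f (p + r • e)) (C := M)
    (fun x _ => (hasDerivAt_line hf e p x).hasDerivWithinAt) (fun x _ => hM _) convex_univ
    trivial trivial
  simpa using this

lemma tendsto_diffQuot (hf : Differentiable ℝ f) (e p : R3) :
    Filter.Tendsto (fun s : ℝ => (f (p + s • e) - f p) / s) (nhdsWithin 0 {0}ᶜ)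
      (nhds (pd e f p)) := by
  have := (hasDerivAt_line hf e p 0).tendsto_slope_zero
  simp only [zero_smul, add_zero, zero_add, smul_eq_mul] at this
  refine this.congr fun s => ?_
  rw [div_eq_inv_mul]

lemma tendsto_avg {F : ℝ → R3 → ℝ} {l : Filter ℝ} [l.IsCountablyGenerated] {M : ℝ}
    (hF : ∀ s, PerCont (F s)) (hM : ∀ᶠ s in l, ∀ p, |F s p| ≤ M)
    (hlim : ∀ p, Filter.Tendsto (fun s => F s p) l (nhds (f p))) :
    Filter.Tendsto (fun s => avg (F s)) l (nhds (avg f)) := by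
  refine tendsto_integral_filter_of_dominated_convergence (fun _ => M)
    (Filter.Eventually.of_forall fun s => (hF s).integrable.aestronglyMeasurable) ?_
    (integrable_const _) (Filter.Eventually.of_forall fun θ => hlim _)
  filter_upwards [hM] with s hs
  exact Filter.Eventually.of_forall fun θ => hs _

lemma PerCont.diffQuot (hf : PerCont f) (e : R3) (s : ℝ) :
    PerCont (fun p => (f (p + s • e) - f p) / s) := by
  simp_rw [div_eq_inv_mul]
  exact ((hf.shift _).sub hf).const_mul _

lemma abs_diffQuot_le (hf : Differentiable ℝ f) (e : R3) {M : ℝ} (hM : ∀ p, |pd e f p| ≤ M)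
    {s : ℝ} (hs : s ≠ 0) (p : R3) : |(f (p + s • e) - f p) / s| ≤ M := by
  rw [abs_div, div_le_iff₀ (abs_pos.2 hs)]
  exact abs_sub_line_le hf e hM p s

lemma tendsto_avg_mul_diffQuot (hf : PerDiff 1 f) (hg : PerCont g) (e : R3) :
    Filter.Tendsto (fun s : ℝ => avg (fun p => g p * ((f (p + s • e) - f p) / s)))
      (nhdsWithin 0 {0}ᶜ) (nhds (avg (fun p => g p * pd e f p))) := by
  obtain ⟨M, hM0, hM⟩ := (hf.pd e).perCont.bounded
  obtain ⟨K, hK0, hK⟩ := hg.bounded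
  refine tendsto_avg (M := K * M) (fun s => hg.mul (hf.perCont.diffQuot e s)) ?_
    (fun p => (tendsto_diffQuot hf.differentiable e p).const_mul _)
  filter_upwards [self_mem_nhdsWithin] with s hs p
  rw [abs_mul]
  exact mul_le_mul (hK p) (abs_diffQuot_le hf.differentiable e hM hs p) (abs_nonneg _) hK0

lemma avg_mul_shift (hf : PerCont f) (hg : PerCont g) (h : R3) :
    avg (fun p => g p * f (p + h)) = avg (fun p => g (p - h) * f p) := by
  rw [← avg_shift (hg.mul (hf.shift h)).per (-h)]
  simp [sub_eq_add_neg]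

lemma avg_mul_diffQuot (hf : PerCont f) (hg : PerCont g) (e : R3) (s : ℝ) :
    avg (fun p => g p * ((f (p + s • e) - f p) / s))
      = - avg (fun p => f p * ((g (p + (-s) • e) - g p) / (-s))) := by
  have h1 : (fun p => g p * ((f (p + s • e) - f p) / s))
      = fun p => s⁻¹ * (g p * f (p + s • e) - g p * f p) := by ext p; ring
  have h2 : (fun p => f p * ((g (p + (-s) • e) - g p) / (-s)))
      = fun p => (-s⁻¹) * (g (p - s • e) * f p - g p * f p) := by
    ext p
    rw [neg_smul, ← sub_eq_add_neg, div_neg, div_eq_inv_mul]; ring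
  have h3 : PerCont fun p => g (p - s • e) * f p := by
    simp_rw [sub_eq_add_neg]; exact (hg.shift _).mul hf
  rw [h1, h2, avg_const_mul, avg_const_mul, avg_sub (hg.mul (hf.shift _)) (hg.mul hf),
    avg_sub h3 (hg.mul hf), avg_mul_shift hf hg]
  ring

lemma tendsto_neg_punctured :
    Filter.Tendsto (fun s : ℝ => -s) (nhdsWithin 0 {0}ᶜ) (nhdsWithin 0 {0}ᶜ) := by
  refine tendsto_nhdsWithin_iff.2 ⟨?_, ?_⟩
  · simpa using (continuous_neg.tendsto (0 : ℝ)).mono_left nhdsWithin_le_nhds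
  · filter_upwards [self_mem_nhdsWithin] with s hs
    simpa using hs

lemma avg_mul_pd (hf : PerDiff 1 f) (hg : PerDiff 1 g) (e : R3) :
    avg (fun p => g p * pd e f p) = - avg (fun p => f p * pd e g p) := by
  refine tendsto_nhds_unique (tendsto_avg_mul_diffQuot hf hg.perCont e) ?_
  simp_rw [avg_mul_diffQuot hf.perCont hg.perCont e]
  exact ((tendsto_avg_mul_diffQuot hg hf.perCont e).comp tendsto_neg_punctured).neg

/-- The null-Lagrangian identity for two `C¹` periodic functions. -/
lemma avg_pd_mul_pd (hf : PerDiff 1 f) (hg : PerDiff 1 g) (a b : R3) :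
    avg (fun p => pd a g p * pd b f p) = avg (fun p => pd b g p * pd a f p) := by
  have h1 := tendsto_avg_mul_diffQuot hf (hg.pd a).perCont b
  refine tendsto_nhds_unique h1 ?_
  have h2 := (tendsto_avg_mul_diffQuot hg (hf.pd a).perCont b).comp tendsto_neg_punctured
  simp_rw [mul_comm (pd b g _)]
  refine h2.congr fun s => ?_
  have hq : ∀ s : ℝ, PerDiff 1 (fun p => (g (p + s • b) - g p) / s) := fun s => by
    simp_rw [div_eq_inv_mul]
    exact (PerDiff.const _).mul ((hg.shift _).sub hg)
  have h4 : ∀ s : ℝ, (pd a fun p => (g (p + s • b) - g p) / s)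
      = fun p => (pd a g (p + s • b) - pd a g p) / s := fun s => by
    ext p
    simp_rw [div_eq_inv_mul]
    rw [pd_mul a (differentiable_const _)
      (((hg.shift _).sub hg).differentiable), pd_sub a (hg.shift _).differentiable
      hg.differentiable, pd_shift]
    simp [pd]
  have h3 := avg_mul_pd hf (hq (-s)) a
  rw [h4] at h3
  rw [avg_mul_diffQuot hf.perCont (hg.pd a).perCont b s, ← h3]
  simp only [Function.comp, mul_comm]

end PerDiffClosure
/-! ### The `L²` estimate for constant coefficients -/

/-- The sum of the squares of the second-order partial derivatives. -/
def hessSq (v : R3 → ℝ) (p : R3) : ℝ :=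
  pd vx (pd vx v) p ^ 2 + pd vy (pd vx v) p ^ 2 + pd vt (pd vx v) p ^ 2
    + pd vy (pd vy v) p ^ 2 + pd vt (pd vy v) p ^ 2 + pd vt (pd vt v) p ^ 2

/-- The sum of the squares of the derivatives of order at most one. -/
def lowSq (v : R3 → ℝ) (p : R3) : ℝ :=
  v p ^ 2 + pd vx v p ^ 2 + pd vy v p ^ 2 + pd vt v p ^ 2

/-- The principal part of the linearized operator, with coefficients frozen. -/
def linOp (A B C D : ℝ) (v : R3 → ℝ) (p : R3) : ℝ :=
  B * pd vx (pd vx v) p + A * (pd vy (pd vy v) p + pd vt (pd vt v) p)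
    - 2 * C * pd vy (pd vx v) p - 2 * D * pd vt (pd vx v) p

lemma pd_lin (a b : ℝ) (e e' : R3) (f : R3 → ℝ) :
    pd (a • e - b • e') f = fun p => a * pd e f p - b * pd e' f p := by
  ext p; simp [pd]

lemma pd_pd_lin {v : R3 → ℝ} (hv : ContDiff ℝ 2 v) (a b c d : ℝ) (e e' g g' p : R3) :
    pd (a • e - b • e') (pd (c • g - d • g') v) p
      = a * (c * pd e (pd g v) p - d * pd e (pd g' v) p)
        - b * (c * pd e' (pd g v) p - d * pd e' (pd g' v) p) := by
  have hd : ∀ e, Differentiable ℝ (pd e v) := fun e =>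
    ((hv.fderiv_right (m := 1) (by norm_num)).clm_apply contDiff_const).differentiable (by simp)
  have h1 : ∀ k : R3, pd k (fun p => c * pd g v p - d * pd g' v p) p
      = c * pd k (pd g v) p - d * pd k (pd g' v) p := fun k => by
    rw [pd_sub k ((hd g).const_mul c) ((hd g').const_mul d)]
    unfold pd at hd ⊢
    rw [fderiv_const_mul (hd g p), fderiv_const_mul (hd g' p)]
    simp
  rw [pd_lin, pd_lin c d]
  simp only [h1]

lemma avg_pd_pd_mul_nonneg {v : R3 → ℝ} (hv : PerDiff 2 v) (a b : R3) :
    avg (fun p => pd a (pd a v) p * pd b (pd b v) p) = avg (fun p => pd b (pd a v) p ^ 2) := by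
  rw [avg_pd_mul_pd (hv.pd b) (hv.pd a) a b]
  congr 1; ext p
  rw [pd_comm hv.diff a b, sq]

lemma sq_le_of_sub_eq {a b c z w y l k m : ℝ} (hl : 0 < l) (ha : l ≤ a) (h : a * z = w + y)
    (hw : w ^ 2 ≤ k * c) (hy : y ^ 2 ≤ m * c) (hb : b = 2 / l ^ 2 * (k + m)) :
    z ^ 2 ≤ b * c := by
  have h1 : l ^ 2 * z ^ 2 ≤ 2 * (k + m) * c := by
    have : l ^ 2 * z ^ 2 ≤ (a * z) ^ 2 := by
      rw [mul_pow]; gcongr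
    rw [h] at this
    nlinarith [sq_nonneg (w - y)]
  rw [hb, div_mul_eq_mul_div, div_mul_eq_mul_div, le_div_iff₀ (by positivity)]
  linarith

lemma mul_sq_le_of_abs_le {a z L k c : ℝ} (ha : |a| ≤ L) (hz : z ^ 2 ≤ k * c) :
    (a * z) ^ 2 ≤ L ^ 2 * k * c := by
  have : a ^ 2 ≤ L ^ 2 := sq_le_sq' (abs_le.1 ha).1 (abs_le.1 ha).2
  rw [mul_pow, mul_assoc]
  exact mul_le_mul this hz (sq_nonneg _) (sq_nonneg _)

set_option maxHeartbeats 1000000 in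
/-- Coercivity of the quadratic form produced by integration by parts. -/
lemma exists_hess_bound (l L : ℝ) (hl : 0 < l) : ∃ K : ℝ, 0 ≤ K ∧
    ∀ A C D E xx xy xt yy yt tt : ℝ, l ≤ A → |A| ≤ L → |C| ≤ L → |D| ≤ L → l ≤ E →
    xx ^ 2 + xy ^ 2 + xt ^ 2 + yy ^ 2 + yt ^ 2 + tt ^ 2 ≤ K *
      ((A ^ 2 * yy - 2 * A * C * xy + C ^ 2 * xx) ^ 2
        + (A ^ 2 * tt - 2 * A * D * xt + D ^ 2 * xx) ^ 2 + E ^ 2 * xx ^ 2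
        + 2 * (A ^ 2 * yt - A * D * xy - A * C * xt + C * D * xx) ^ 2
        + 2 * E * (A * xy - C * xx) ^ 2 + 2 * E * (A * xt - D * xx) ^ 2) := by
  obtain ⟨k1, hk1⟩ : ∃ k, k = 2 / l ^ 2 * (1 + 0) := ⟨_, rfl⟩
  obtain ⟨k2, hk2⟩ : ∃ k, k = 2 / l ^ 2 * (1 / l + L ^ 2 * k1) := ⟨_, rfl⟩
  obtain ⟨K, hK⟩ : ∃ K, K = 4 * l⁻¹ ^ 4 * (2 + 8 * L ^ 4 * k2 + L ^ 4 * k1) := ⟨_, rfl⟩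
  have hk1' : 0 ≤ k1 := by rw [hk1]; positivity
  have hk2' : 0 ≤ k2 := by rw [hk2]; positivity
  have hK' : 0 ≤ K := by rw [hK]; positivity
  refine ⟨k1 + 2 * k2 + 3 * K, by positivity, ?_⟩
  intro A C D E xx xy xt yy yt tt hA hAL hC hD hE
  obtain ⟨a1, h1⟩ : ∃ a, a = A ^ 2 * yy - 2 * A * C * xy + C ^ 2 * xx := ⟨_, rfl⟩
  obtain ⟨a2, h2⟩ : ∃ a, a = A ^ 2 * tt - 2 * A * D * xt + D ^ 2 * xx := ⟨_, rfl⟩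
  obtain ⟨a3, h3⟩ : ∃ a, a = A ^ 2 * yt - A * D * xy - A * C * xt + C * D * xx := ⟨_, rfl⟩
  obtain ⟨a4, h4⟩ : ∃ a, a = A * xy - C * xx := ⟨_, rfl⟩
  obtain ⟨a5, h5⟩ : ∃ a, a = A * xt - D * xx := ⟨_, rfl⟩
  rw [← h1, ← h2, ← h3, ← h4, ← h5]
  obtain ⟨P, hP⟩ : ∃ P, P = a1 ^ 2 + a2 ^ 2 + E ^ 2 * xx ^ 2 + 2 * a3 ^ 2 + 2 * E * a4 ^ 2
    + 2 * E * a5 ^ 2 := ⟨_, rfl⟩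
  rw [← hP]
  have hE0 : 0 < E := hl.trans_le hE
  have e1 := sq_nonneg a1
  have e2 := sq_nonneg a2
  have e3 : 0 ≤ (E * xx) ^ 2 := sq_nonneg _
  have e4 := sq_nonneg a3
  have e5 : l * a4 ^ 2 ≤ E * a4 ^ 2 := by gcongr
  have e6 : l * a5 ^ 2 ≤ E * a5 ^ 2 := by gcongr
  have e5' : 0 ≤ l * a4 ^ 2 := by positivity
  have e6' : 0 ≤ l * a5 ^ 2 := by positivity
  have hP0 : 0 ≤ P := by rw [hP]; positivity
  have hxx : xx ^ 2 ≤ k1 * P :=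
    sq_le_of_sub_eq (w := E * xx) (y := 0) (k := 1) (m := 0) hl hE (by ring)
      (by linarith) (by simp) hk1
  have hYX : a4 ^ 2 ≤ 1 / l * P := by
    rw [div_mul_eq_mul_div, le_div_iff₀ hl]; linarith
  have hTX : a5 ^ 2 ≤ 1 / l * P := by
    rw [div_mul_eq_mul_div, le_div_iff₀ hl]; linarith
  have hxy : xy ^ 2 ≤ k2 * P :=
    sq_le_of_sub_eq (w := a4) (y := C * xx) hl hA (by rw [h4]; ring) hYX
      (mul_sq_le_of_abs_le hC hxx) hk2
  have hxt : xt ^ 2 ≤ k2 * P :=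
    sq_le_of_sub_eq (w := a5) (y := D * xx) hl hA (by rw [h5]; ring) hTX
      (mul_sq_le_of_abs_le hD hxx) hk2
  have hprod : ∀ a b : ℝ, |a| ≤ L → |b| ≤ L → |a * b| ≤ L ^ 2 := fun a b ha hb => by
    rw [abs_mul, sq]
    exact mul_le_mul ha hb (abs_nonneg _) ((abs_nonneg _).trans ha)
  have hpow : ∀ z w : ℝ, A ^ 2 * z = w → w ^ 2 ≤ 4 * (2 + 8 * L ^ 4 * k2 + L ^ 4 * k1) * P →
      z ^ 2 ≤ K * P := fun z w hzw hw => by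
    have h1 : l ^ 4 * z ^ 2 ≤ (A ^ 2 * z) ^ 2 := by
      rw [mul_pow, ← pow_mul]; gcongr
    rw [hzw] at h1
    have h2 := mul_le_mul_of_nonneg_left (h1.trans hw) (show 0 ≤ l⁻¹ ^ 4 by positivity)
    rw [← mul_assoc, ← mul_pow, inv_mul_cancel₀ hl.ne', one_pow, one_mul] at h2
    rw [hK]; linarith
  have hquad : ∀ a b c d : ℝ, (a + b + c + d) ^ 2 ≤ 4 * (a ^ 2 + b ^ 2 + c ^ 2 + d ^ 2) :=
    fun a b c d => by
      nlinarith [sq_nonneg (a - b), sq_nonneg (a - c), sq_nonneg (a - d), sq_nonneg (b - c),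
        sq_nonneg (b - d), sq_nonneg (c - d)]
  have hk2P : 0 ≤ L ^ 4 * k2 * P := by positivity
  have hk1P : 0 ≤ L ^ 4 * k1 * P := by positivity
  have hAC := mul_sq_le_of_abs_le (hprod A C hAL hC) hxy
  have hAD := mul_sq_le_of_abs_le (hprod A D hAL hD) hxt
  have hAC' := mul_sq_le_of_abs_le (hprod A C hAL hC) hxt
  have hAD' := mul_sq_le_of_abs_le (hprod A D hAL hD) hxy
  have hCC := mul_sq_le_of_abs_le (hprod C C hC hC) hxx
  have hDD := mul_sq_le_of_abs_le (hprod D D hD hD) hxx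
  have hCD := mul_sq_le_of_abs_le (hprod C D hC hD) hxx
  have hyy : yy ^ 2 ≤ K * P := by
    refine hpow yy (a1 + 2 * (A * C * xy) + -(C * C * xx) + 0) (by rw [h1]; ring) ?_
    refine (hquad _ _ _ _).trans ?_
    linarith
  have htt : tt ^ 2 ≤ K * P := by
    refine hpow tt (a2 + 2 * (A * D * xt) + -(D * D * xx) + 0) (by rw [h2]; ring) ?_
    refine (hquad _ _ _ _).trans ?_
    linarith
  have hyt : yt ^ 2 ≤ K * P := by
    refine hpow yt (a3 + A * D * xy + A * C * xt + -(C * D * xx)) (by rw [h3]; ring) ?_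
    refine (hquad _ _ _ _).trans ?_
    linarith
  linarith

lemma PerDiff.hessSq {v : R3 → ℝ} (hv : PerDiff 2 v) : PerCont (hessSq v) :=
  (((((((hv.pd vx).pd vx).perCont.sq.add ((hv.pd vx).pd vy).perCont.sq).add
    ((hv.pd vx).pd vt).perCont.sq).add ((hv.pd vy).pd vy).perCont.sq).add
    ((hv.pd vy).pd vt).perCont.sq).add ((hv.pd vt).pd vt).perCont.sq)

lemma PerDiff.lowSq {v : R3 → ℝ} (hv : PerDiff 2 v) : PerCont (lowSq v) :=
  ((hv.perCont.sq.add (hv.pd vx).perCont.sq).add (hv.pd vy).perCont.sq).add (hv.pd vt).perCont.sq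

lemma PerDiff.linOp {v a b c d : R3 → ℝ} (hv : PerDiff 2 v) (ha : PerCont a) (hb : PerCont b)
    (hc : PerCont c) (hd : PerCont d) : PerCont (fun p => linOp (a p) (b p) (c p) (d p) v p) :=
  (((hb.mul ((hv.pd vx).pd vx).perCont).add (ha.mul (((hv.pd vy).pd vy).perCont.add
    ((hv.pd vt).pd vt).perCont))).sub ((hc.const_mul 2).mul ((hv.pd vx).pd vy).perCont)).sub
    ((hd.const_mul 2).mul ((hv.pd vx).pd vt).perCont)

/-- The `L²` estimate for an elliptic operator with constant coefficients. -/
lemma exists_const_coeff_estimate (l L : ℝ) (hl : 0 < l) : ∃ K : ℝ, 0 ≤ K ∧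
    ∀ A B C D : ℝ, l ≤ A → |A| ≤ L → |C| ≤ L → |D| ≤ L → l ≤ A * B - C ^ 2 - D ^ 2 →
    ∀ v, PerDiff 2 v → avg (hessSq v) ≤ K * avg (fun p => linOp A B C D v p ^ 2) := by
  obtain ⟨K, hK, hbound⟩ := exists_hess_bound l L hl
  refine ⟨K * L ^ 2, by positivity, ?_⟩
  intro A B C D hA hAL hC hD hE v hv
  obtain ⟨E, hEdef⟩ : ∃ E, E = A * B - C ^ 2 - D ^ 2 := ⟨_, rfl⟩
  rw [← hEdef] at hE
  have hE0 : 0 < E := hl.trans_le hE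
  have hv2 : ContDiff ℝ 2 v := hv.diff
  obtain ⟨Y, hY⟩ : ∃ Y, Y = A • vy - C • vx := ⟨_, rfl⟩
  obtain ⟨T, hT⟩ : ∃ T, T = A • vt - D • vx := ⟨_, rfl⟩
  obtain ⟨X, hX⟩ : ∃ X, X = (1 : ℝ) • vx - (0 : ℝ) • vx := ⟨_, rfl⟩
  have cyx : ∀ p, pd vx (pd vy v) p = pd vy (pd vx v) p := fun p => pd_comm hv2 _ _ p
  have ctx : ∀ p, pd vx (pd vt v) p = pd vt (pd vx v) p := fun p => pd_comm hv2 _ _ p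
  have c2 : ∀ a b, PerCont (pd a (pd b v)) := fun a b => ((hv.pd b).pd a).perCont
  have h1 := avg_pd_pd_mul_nonneg hv Y T
  have h2 := avg_pd_pd_mul_nonneg hv Y X
  have h3 := avg_pd_pd_mul_nonneg hv T X
  have hsq : (fun p => (A * linOp A B C D v p) ^ 2) = fun p =>
      (pd Y (pd Y v) p ^ 2 + pd T (pd T v) p ^ 2 + E ^ 2 * pd X (pd X v) p ^ 2)
      + (2 * (pd Y (pd Y v) p * pd T (pd T v) p) + 2 * E * (pd Y (pd Y v) p * pd X (pd X v) p)
      + 2 * E * (pd T (pd T v) p * pd X (pd X v) p)) := by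
    ext p
    subst hY hT hX
    simp only [pd_pd_lin hv2, cyx, ctx, linOp, hEdef]
    ring
  have hfun : ∀ p, hessSq v p ≤ K *
      ((pd Y (pd Y v) p ^ 2 + pd T (pd T v) p ^ 2 + E ^ 2 * pd X (pd X v) p ^ 2)
      + (2 * pd T (pd Y v) p ^ 2 + 2 * E * pd X (pd Y v) p ^ 2
        + 2 * E * pd X (pd T v) p ^ 2)) := fun p => by
    refine (hbound A C D E _ _ _ _ _ _ hA hAL hC hD hE).trans (le_of_eq ?_)
    subst hY hT hX
    simp only [pd_pd_lin hv2, cyx, ctx]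
    ring
  have p1 := ((c2 Y Y).sq.add (c2 T T).sq).add ((c2 X X).sq.const_mul (E ^ 2))
  have p2 := (((c2 T Y).sq.const_mul 2).add ((c2 X Y).sq.const_mul (2 * E))).add
    ((c2 X T).sq.const_mul (2 * E))
  have p3 := ((((c2 Y Y).mul (c2 T T)).const_mul 2).add
    (((c2 Y Y).mul (c2 X X)).const_mul (2 * E))).add
    (((c2 T T).mul (c2 X X)).const_mul (2 * E))
  have hmid := avg_mono hv.hessSq ((p1.add p2).const_mul K) hfun
  have heq : avg (fun p => (A * linOp A B C D v p) ^ 2) = avg (fun p =>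
      (pd Y (pd Y v) p ^ 2 + pd T (pd T v) p ^ 2 + E ^ 2 * pd X (pd X v) p ^ 2)
      + (2 * pd T (pd Y v) p ^ 2 + 2 * E * pd X (pd Y v) p ^ 2
        + 2 * E * pd X (pd T v) p ^ 2)) := by
    rw [hsq, avg_add p1 p3, avg_add p1 p2]
    congr 1
    rw [avg_add (((c2 T Y).sq.const_mul 2).add ((c2 X Y).sq.const_mul (2 * E)))
        ((c2 X T).sq.const_mul (2 * E)),
      avg_add ((c2 T Y).sq.const_mul 2) ((c2 X Y).sq.const_mul (2 * E)),
      avg_add ((((c2 Y Y).mul (c2 T T)).const_mul 2).add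
        (((c2 Y Y).mul (c2 X X)).const_mul (2 * E))) (((c2 T T).mul (c2 X X)).const_mul (2 * E)),
      avg_add (((c2 Y Y).mul (c2 T T)).const_mul 2) (((c2 Y Y).mul (c2 X X)).const_mul (2 * E))]
    simp only [avg_const_mul, h1, h2, h3]
  rw [avg_const_mul, ← heq] at hmid
  refine hmid.trans ?_
  simp_rw [mul_pow]
  rw [avg_const_mul, ← mul_assoc]
  have : A ^ 2 ≤ L ^ 2 := sq_le_sq' (abs_le.1 hAL).1 (abs_le.1 hAL).2
  have h0 : 0 ≤ avg fun p => linOp A B C D v p ^ 2 := avg_nonneg fun p => sq_nonneg _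
  gcongr
/-! ### The `L²` estimate for continuous coefficients -/

lemma continuous_toTorus : Continuous toTorus := by
  refine continuous_pi fun i => ?_
  fin_cases i <;> simp only [toTorus] <;>
    exact (AddCircle.continuous_mk' 1).comp (by fun_prop)

lemma PerCont.uniformContinuous {f : R3 → ℝ} (hf : PerCont f) : UniformContinuous f := by
  have h1 : UniformContinuous fun θ => f (torusSec θ) :=
    CompactSpace.uniformContinuous_of_continuous hf.continuous_torusSec
  have h2 : UniformContinuous toTorus :=
    uniformContinuous_addMonoidHom_of_continuous (f := AddMonoidHom.mk' toTorus toTorus_add)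
      continuous_toTorus
  have h3 : f = (fun θ => f (torusSec θ)) ∘ toTorus := by
    ext p; exact (hf.per.apply_torusSec p).symm
  rw [h3]
  exact h1.comp h2

lemma PerCont.exists_modulus {f : R3 → ℝ} (hf : PerCont f) {ε : ℝ} (hε : 0 < ε) :
    ∃ δ, 0 < δ ∧ ∀ p q : R3, ‖p - q‖ < δ → |f p - f q| ≤ ε := by
  obtain ⟨δ, hδ, h⟩ := Metric.uniformContinuous_iff.1 hf.uniformContinuous ε hε
  refine ⟨δ, hδ, fun p q hpq => ?_⟩
  have := h (a := p) (b := q) (by rwa [dist_eq_norm])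
  rw [Real.dist_eq] at this
  exact this.le

lemma abs_sub_round_lt_of_cos {δ x : ℝ} (hδ : 0 < δ)
    (h : 1 - 8 * δ ^ 2 < Real.cos (2 * Real.pi * x)) : |x - round x| < δ := by
  have h1 : Real.cos (2 * Real.pi * x) = Real.cos (2 * Real.pi * (x - round x)) := by
    rw [mul_sub, mul_comm (2 * Real.pi) (round x : ℝ), Real.cos_sub_int_mul_two_pi]
  have h2 := abs_sub_round x
  have h3 : |2 * Real.pi * (x - round x)| ≤ Real.pi := by
    rw [abs_mul, abs_of_pos (by positivity)]
    nlinarith [Real.pi_pos]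
  have h4 := Real.cos_le_one_sub_mul_cos_sq h3
  rw [← h1] at h4
  have h5 : 2 / Real.pi ^ 2 * (2 * Real.pi * (x - round x)) ^ 2 = 8 * (x - round x) ^ 2 := by
    field_simp; ring
  rw [h5] at h4
  exact abs_lt_of_sq_lt_sq (by linarith) hδ.le

/-- Smooth periodic functions supported near the integer lattice. -/
lemma exists_cutoff {δ : ℝ} (hδ : 0 < δ) : ∃ η : R3 → ℝ, (∀ n, PerDiff n η) ∧ 0 < η 0 ∧
    ∀ p, η p ≠ 0 → ∃ a b c : ℤ, ‖p - ((a : ℝ), (b : ℝ), (c : ℝ))‖ < δ := by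
  refine ⟨fun p => Real.smoothTransition (Real.cos (2 * Real.pi * p.1)
    + Real.cos (2 * Real.pi * p.2.1) + Real.cos (2 * Real.pi * p.2.2) - 3 + 8 * δ ^ 2),
    fun n => ⟨fun p => ?_, ?_⟩, ?_, fun p hp => ?_⟩
  · simp [vx, vy, vt, mul_add]
  · exact Real.smoothTransition.contDiff.comp (by fun_prop)
  · refine Real.smoothTransition.pos_of_pos ?_
    simp only [Prod.fst_zero, Prod.snd_zero, mul_zero, Real.cos_zero]
    ring_nf; positivity
  · have h : 0 < Real.cos (2 * Real.pi * p.1) + Real.cos (2 * Real.pi * p.2.1)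
        + Real.cos (2 * Real.pi * p.2.2) - 3 + 8 * δ ^ 2 := by
      by_contra hcon
      exact hp (Real.smoothTransition.zero_of_nonpos (not_lt.1 hcon))
    have c1 := Real.cos_le_one (2 * Real.pi * p.1)
    have c2 := Real.cos_le_one (2 * Real.pi * p.2.1)
    have c3 := Real.cos_le_one (2 * Real.pi * p.2.2)
    refine ⟨round p.1, round p.2.1, round p.2.2, ?_⟩
    simp only [Prod.norm_def, Prod.fst_sub, Prod.snd_sub, Real.norm_eq_abs, sup_lt_iff]
    exact ⟨abs_sub_round_lt_of_cos hδ (by linarith), abs_sub_round_lt_of_cos hδ (by linarith),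
      abs_sub_round_lt_of_cos hδ (by linarith)⟩

lemma pd_pd_mul {f g : R3 → ℝ} (hf : PerDiff 2 f) (hg : PerDiff 2 g) (a b p : R3) :
    pd a (pd b (fun q => f q * g q)) p
      = f p * pd a (pd b g) p + (pd a f p * pd b g p + pd b f p * pd a g p
        + pd a (pd b f) p * g p) := by
  have h : pd b (fun q => f q * g q) = fun q => f q * pd b g q + g q * pd b f q := by
    ext q; exact pd_mul b hf.differentiable hg.differentiable q
  have d1 : Differentiable ℝ fun q => f q * pd b g q :=
    hf.differentiable.mul (hg.pd b).differentiable
  have d2 : Differentiable ℝ fun q => g q * pd b f q :=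
    hg.differentiable.mul (hf.pd b).differentiable
  rw [h, pd_add a d1 d2, pd_mul a hf.differentiable (hg.pd b).differentiable,
    pd_mul a hg.differentiable (hf.pd b).differentiable]
  ring

lemma cross_sq_le {M x1 x2 x3 y1 y2 y3 S : ℝ} (h1 : x1 ^ 2 ≤ M) (h2 : x2 ^ 2 ≤ M)
    (h3 : x3 ^ 2 ≤ M) (hy1 : y1 ^ 2 + y3 ^ 2 ≤ S) (hy2 : y2 ^ 2 ≤ S) :
    (x1 * y1 + x2 * y2 + x3 * y3) ^ 2 ≤ 6 * M * S := by
  have hM : 0 ≤ M := (sq_nonneg _).trans h1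
  have e1 : x1 ^ 2 * y1 ^ 2 ≤ M * y1 ^ 2 := by gcongr
  have e2 : x2 ^ 2 * y2 ^ 2 ≤ M * y2 ^ 2 := by gcongr
  have e3 : x3 ^ 2 * y3 ^ 2 ≤ M * y3 ^ 2 := by gcongr
  have e4 : M * (y1 ^ 2 + y3 ^ 2) ≤ M * S := by gcongr
  have e5 : M * y2 ^ 2 ≤ M * S := by gcongr
  nlinarith [sq_nonneg (x1 * y1 - x2 * y2), sq_nonneg (x1 * y1 - x3 * y3),
    sq_nonneg (x2 * y2 - x3 * y3)]

lemma sq_mul_hess_le {k r1 r2 r3 r4 r5 r6 v1 v2 v3 v4 v5 v6 R : ℝ} (h1 : r1 ^ 2 ≤ R)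
    (h2 : r2 ^ 2 ≤ R) (h3 : r3 ^ 2 ≤ R) (h4 : r4 ^ 2 ≤ R) (h5 : r5 ^ 2 ≤ R) (h6 : r6 ^ 2 ≤ R) :
    k ^ 2 * (v1 ^ 2 + v2 ^ 2 + v3 ^ 2 + v4 ^ 2 + v5 ^ 2 + v6 ^ 2)
      ≤ 2 * ((k * v1 + r1) ^ 2 + (k * v2 + r2) ^ 2 + (k * v3 + r3) ^ 2 + (k * v4 + r4) ^ 2
        + (k * v5 + r5) ^ 2 + (k * v6 + r6) ^ 2) + 12 * R := by
  have key : ∀ v r : ℝ, r ^ 2 ≤ R → k ^ 2 * v ^ 2 ≤ 2 * (k * v + r) ^ 2 + 2 * R := fun v r h => by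
    nlinarith [sq_nonneg (k * v + 2 * r)]
  linarith [key v1 r1 h1, key v2 r2 h2, key v3 r3 h3, key v4 r4 h4, key v5 r5 h5, key v6 r6 h6]

lemma five_sq_le {A B C D L xx xy xt yy tt R : ℝ} (hA : A ^ 2 ≤ L) (hB : B ^ 2 ≤ L)
    (hC : C ^ 2 ≤ L) (hD : D ^ 2 ≤ L)
    (hR : xx ^ 2 + 4 * xy ^ 2 + 4 * xt ^ 2 + yy ^ 2 + tt ^ 2 ≤ R) :
    (B * xx + A * (yy + tt) - 2 * C * xy - 2 * D * xt) ^ 2 ≤ 5 * L * R := by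
  have hL : 0 ≤ L := (sq_nonneg _).trans hA
  have e1 : B ^ 2 * xx ^ 2 ≤ L * xx ^ 2 := by gcongr
  have e2 : A ^ 2 * yy ^ 2 ≤ L * yy ^ 2 := by gcongr
  have e3 : A ^ 2 * tt ^ 2 ≤ L * tt ^ 2 := by gcongr
  have e4 : C ^ 2 * xy ^ 2 ≤ L * xy ^ 2 := by gcongr
  have e5 : D ^ 2 * xt ^ 2 ≤ L * xt ^ 2 := by gcongr
  have e6 : L * (xx ^ 2 + 4 * xy ^ 2 + 4 * xt ^ 2 + yy ^ 2 + tt ^ 2) ≤ L * R := by gcongr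
  have key : ∀ a b c d e : ℝ, (a + b + c + d + e) ^ 2
      ≤ 5 * (a ^ 2 + b ^ 2 + c ^ 2 + d ^ 2 + e ^ 2) := fun a b c d e => by
    linarith [sq_nonneg (a - b), sq_nonneg (a - c), sq_nonneg (a - d), sq_nonneg (a - e),
      sq_nonneg (b - c), sq_nonneg (b - d), sq_nonneg (b - e), sq_nonneg (c - d),
      sq_nonneg (c - e), sq_nonneg (d - e)]
  have := key (B * xx) (A * yy) (A * tt) (-(2 * C * xy)) (-(2 * D * xt))
  linarith

/-- Localization of the second derivatives by a cutoff function. -/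
lemma sq_mul_hessSq_le {η v : R3 → ℝ} (hη : PerDiff 2 η) (hv : PerDiff 2 v) {M : ℝ}
    (p : R3) (hM : lowSq η p + hessSq η p ≤ M) :
    η p ^ 2 * hessSq v p ≤ 2 * hessSq (fun q => η q * v q) p + 72 * M * lowSq v p := by
  have hl : ∀ a b c d e f g h i j : ℝ, a ^ 2 + b ^ 2 + c ^ 2 + d ^ 2 + (e ^ 2 + f ^ 2 + g ^ 2
    + h ^ 2 + i ^ 2 + j ^ 2) ≤ M → b ^ 2 ≤ M ∧ c ^ 2 ≤ M ∧ d ^ 2 ≤ M ∧ e ^ 2 ≤ M ∧ f ^ 2 ≤ M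
    ∧ g ^ 2 ≤ M ∧ h ^ 2 ≤ M ∧ i ^ 2 ≤ M ∧ j ^ 2 ≤ M := by
    intro a b c d e f g h i j hh
    refine ⟨?_, ?_, ?_, ?_, ?_, ?_, ?_, ?_, ?_⟩ <;> nlinarith [sq_nonneg a, sq_nonneg b,
      sq_nonneg c, sq_nonneg d, sq_nonneg e, sq_nonneg f, sq_nonneg g, sq_nonneg h,
      sq_nonneg i, sq_nonneg j]
  obtain ⟨m1, m2, m3, m4, m5, m6, m7, m8, m9⟩ := hl _ _ _ _ _ _ _ _ _ _ hM
  have s0 := sq_nonneg (v p)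
  have s1 := sq_nonneg (pd vx v p)
  have s2 := sq_nonneg (pd vy v p)
  have s3 := sq_nonneg (pd vt v p)
  obtain ⟨r, hr⟩ : ∃ r : R3 → R3 → ℝ, r = fun a b => pd a η p * pd b v p + pd b η p * pd a v p
    + pd a (pd b η) p * v p := ⟨_, rfl⟩
  have hrs : r vx vx ^ 2 ≤ 6 * M * lowSq v p ∧ r vy vx ^ 2 ≤ 6 * M * lowSq v p ∧
      r vt vx ^ 2 ≤ 6 * M * lowSq v p ∧ r vy vy ^ 2 ≤ 6 * M * lowSq v p ∧
      r vt vy ^ 2 ≤ 6 * M * lowSq v p ∧ r vt vt ^ 2 ≤ 6 * M * lowSq v p := by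
    rw [hr]
    refine ⟨?_, ?_, ?_, ?_, ?_, ?_⟩ <;>
      (apply cross_sq_le <;> first | assumption | (unfold lowSq; linarith))
  obtain ⟨r1, r2, r3, r4, r5, r6⟩ := hrs
  have h := sq_mul_hess_le (k := η p) (v1 := pd vx (pd vx v) p) (v2 := pd vy (pd vx v) p)
    (v3 := pd vt (pd vx v) p) (v4 := pd vy (pd vy v) p) (v5 := pd vt (pd vy v) p)
    (v6 := pd vt (pd vt v) p) r1 r2 r3 r4 r5 r6
  rw [hr] at h
  unfold hessSq
  simp only [pd_pd_mul hη hv]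
  linarith

/-- Comparison of the frozen operator on the localized function with the original one. -/
lemma linOp_cutoff_sq_le {η v a b c d : R3 → ℝ} (hη : PerDiff 2 η) (hv : PerDiff 2 v)
    {M L ε : ℝ} (p z : R3) (hM : lowSq η p + hessSq η p ≤ M)
    (ha : a z ^ 2 ≤ L) (hb : b z ^ 2 ≤ L) (hc : c z ^ 2 ≤ L) (hd : d z ^ 2 ≤ L)
    (hε : η p ≠ 0 → (a z - a p) ^ 2 ≤ ε ∧ (b z - b p) ^ 2 ≤ ε ∧ (c z - c p) ^ 2 ≤ ε ∧
      (d z - d p) ^ 2 ≤ ε) :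
    linOp (a z) (b z) (c z) (d z) (fun q => η q * v q) p ^ 2
      ≤ 3 * M * linOp (a p) (b p) (c p) (d p) v p ^ 2 + 60 * ε * (η p ^ 2 * hessSq v p)
        + 990 * L * M * lowSq v p := by
  have hl : ∀ a b c d e f g h i j : ℝ, a ^ 2 + b ^ 2 + c ^ 2 + d ^ 2 + (e ^ 2 + f ^ 2 + g ^ 2
    + h ^ 2 + i ^ 2 + j ^ 2) ≤ M → a ^ 2 ≤ M ∧ b ^ 2 ≤ M ∧ c ^ 2 ≤ M ∧ d ^ 2 ≤ M ∧ e ^ 2 ≤ M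
    ∧ f ^ 2 ≤ M ∧ g ^ 2 ≤ M ∧ h ^ 2 ≤ M ∧ i ^ 2 ≤ M ∧ j ^ 2 ≤ M := by
    intro a b c d e f g h i j hh
    refine ⟨?_, ?_, ?_, ?_, ?_, ?_, ?_, ?_, ?_, ?_⟩ <;> nlinarith [sq_nonneg a, sq_nonneg b,
      sq_nonneg c, sq_nonneg d, sq_nonneg e, sq_nonneg f, sq_nonneg g, sq_nonneg h,
      sq_nonneg i, sq_nonneg j]
  obtain ⟨m0, m1, m2, m3, m4, m5, m6, m7, m8, m9⟩ := hl _ _ _ _ _ _ _ _ _ _ hM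
  have s0 := sq_nonneg (v p)
  have s1 := sq_nonneg (pd vx v p)
  have s2 := sq_nonneg (pd vy v p)
  have s3 := sq_nonneg (pd vt v p)
  obtain ⟨r, hr⟩ : ∃ r : R3 → R3 → ℝ, r = fun a b => pd a η p * pd b v p + pd b η p * pd a v p
    + pd a (pd b η) p * v p := ⟨_, rfl⟩
  have hrs : r vx vx ^ 2 ≤ 6 * M * lowSq v p ∧ r vy vx ^ 2 ≤ 6 * M * lowSq v p ∧
      r vt vx ^ 2 ≤ 6 * M * lowSq v p ∧ r vy vy ^ 2 ≤ 6 * M * lowSq v p ∧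
      r vt vt ^ 2 ≤ 6 * M * lowSq v p := by
    rw [hr]
    refine ⟨?_, ?_, ?_, ?_, ?_⟩ <;>
      (apply cross_sq_le <;> first | assumption | (unfold lowSq; linarith))
  obtain ⟨r1, r2, r3, r4, r5⟩ := hrs
  obtain ⟨ℓ, hℓ⟩ : ∃ ℓ, ℓ = b z * r vx vx + a z * (r vy vy + r vt vt) - 2 * c z * r vy vx
    - 2 * d z * r vt vx := ⟨_, rfl⟩
  have hℓ2 : ℓ ^ 2 ≤ 5 * L * (66 * M * lowSq v p) := by
    rw [hℓ]
    exact five_sq_le ha hb hc hd (by linarith)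
  have hdiff : (η p * linOp (a z - a p) (b z - b p) (c z - c p) (d z - d p) v p) ^ 2
      ≤ 20 * ε * (η p ^ 2 * hessSq v p) := by
    by_cases h0 : η p = 0
    · simp [h0]
    obtain ⟨h1, h2, h3, h4⟩ := hε h0
    have := five_sq_le h1 h2 h3 h4 (R := 4 * hessSq v p) (xx := pd vx (pd vx v) p)
      (xy := pd vy (pd vx v) p) (xt := pd vt (pd vx v) p) (yy := pd vy (pd vy v) p)
      (tt := pd vt (pd vt v) p) (by
        unfold hessSq
        linarith [sq_nonneg (pd vx (pd vx v) p), sq_nonneg (pd vt (pd vy v) p),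
          sq_nonneg (pd vy (pd vy v) p), sq_nonneg (pd vt (pd vt v) p)])
    rw [mul_pow]
    have h5 := mul_le_mul_of_nonneg_left this (sq_nonneg (η p))
    unfold linOp
    linarith
  have hmain : (η p * linOp (a p) (b p) (c p) (d p) v p) ^ 2
      ≤ M * linOp (a p) (b p) (c p) (d p) v p ^ 2 := by
    rw [mul_pow]; gcongr
  have heq : linOp (a z) (b z) (c z) (d z) (fun q => η q * v q) p
      = η p * linOp (a p) (b p) (c p) (d p) v p
        + η p * linOp (a z - a p) (b z - b p) (c z - c p) (d z - d p) v p + ℓ := by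
    rw [hℓ, hr]
    unfold linOp
    simp only [pd_pd_mul hη hv]
    ring
  rw [heq]
  have key : ∀ x y w : ℝ, (x + y + w) ^ 2 ≤ 3 * (x ^ 2 + y ^ 2 + w ^ 2) := fun x y w => by
    linarith [sq_nonneg (x - y), sq_nonneg (x - w), sq_nonneg (y - w)]
  refine (key _ _ _).trans ?_
  linarith
lemma avg_finset_sum {ι : Type*} (s : Finset ι) {f : ι → R3 → ℝ} (hf : ∀ i ∈ s, PerCont (f i)) :
    avg (fun p => ∑ i ∈ s, f i p) = ∑ i ∈ s, avg (f i) :=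
  integral_finsetSum s fun i hi => (hf i hi).integrable

lemma PerCont.sum {ι : Type*} (s : Finset ι) {f : ι → R3 → ℝ} (hf : ∀ i ∈ s, PerCont (f i)) :
    PerCont (fun p => ∑ i ∈ s, f i p) := by
  refine ⟨fun p => ?_, continuous_finsetSum s fun i hi => (hf i hi).cont⟩
  refine ⟨?_, ?_, ?_⟩ <;> refine Finset.sum_congr rfl fun i hi => ?_
  exacts [((hf i hi).per p).1, ((hf i hi).per p).2.1, ((hf i hi).per p).2.2]

lemma avg_add_three {f g h : R3 → ℝ} (hf : PerCont f) (hg : PerCont g) (hh : PerCont h)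
    (x y z : ℝ) : avg (fun p => x * f p + y * g p + z * h p)
      = x * avg f + y * avg g + z * avg h := by
  rw [avg_add ((hf.const_mul x).add (hg.const_mul y)) (hh.const_mul z),
    avg_add (hf.const_mul x) (hg.const_mul y), avg_const_mul, avg_const_mul, avg_const_mul]

lemma avg_add_two {f g : R3 → ℝ} (hf : PerCont f) (hg : PerCont g) (x y : ℝ) :
    avg (fun p => x * f p + y * g p) = x * avg f + y * avg g := by
  rw [avg_add (hf.const_mul x) (hg.const_mul y), avg_const_mul, avg_const_mul]

/-- The second-order estimate for functions localized by a cutoff on whose support the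
coefficients are almost constant. -/
lemma local_estimate {a b c d η : R3 → ℝ} (ha : PerCont a) (hb : PerCont b) (hc : PerCont c)
    (hd : PerCont d) (hη : PerDiff 2 η) {K L ε : ℝ} (hK : 0 ≤ K) (hε : 240 * K * ε ≤ 1) (z : R3)
    (hK' : ∀ v, PerDiff 2 v →
      avg (hessSq v) ≤ K * avg (fun p => linOp (a z) (b z) (c z) (d z) v p ^ 2))
    (hL : a z ^ 2 ≤ L ∧ b z ^ 2 ≤ L ∧ c z ^ 2 ≤ L ∧ d z ^ 2 ≤ L)
    (hη' : ∀ p, η p ≠ 0 → (a z - a p) ^ 2 ≤ ε ∧ (b z - b p) ^ 2 ≤ ε ∧ (c z - c p) ^ 2 ≤ ε ∧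
      (d z - d p) ^ 2 ≤ ε) :
    ∃ C, 0 ≤ C ∧ ∀ v, PerDiff 2 v → avg (fun p => η p ^ 2 * hessSq v p)
      ≤ C * (avg (fun p => linOp (a p) (b p) (c p) (d p) v p ^ 2) + avg (lowSq v)) := by
  obtain ⟨M, hM0, hM⟩ := ((PerDiff.lowSq hη).add (PerDiff.hessSq hη)).bounded
  have hL0 : 0 ≤ L := (sq_nonneg _).trans hL.1
  refine ⟨12 * K * M + (144 * M + 3960 * K * L * M), by positivity, fun v hv => ?_⟩
  have cl := PerDiff.lowSq hv
  have ch := PerDiff.hessSq hv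
  have co := (PerDiff.linOp hv ha hb hc hd).sq
  have hηv : PerDiff 2 (fun q => η q * v q) := hη.mul hv
  have chv := PerDiff.hessSq hηv
  have cηh : PerCont fun p => η p ^ 2 * hessSq v p := hη.perCont.sq.mul ch
  have coz : PerCont fun p => linOp (a z) (b z) (c z) (d z) (fun q => η q * v q) p ^ 2 :=
    (PerDiff.linOp hηv (PerCont.const _) (PerCont.const _) (PerCont.const _) (PerCont.const _)).sq
  have hMp : ∀ p, lowSq η p + hessSq η p ≤ M := fun p => (le_abs_self _).trans (hM p)
  have i1 := avg_mono cηh ((chv.const_mul 2).add (cl.const_mul (72 * M)))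
    fun p => sq_mul_hessSq_le hη hv p (hMp p)
  rw [avg_add_two chv cl] at i1
  have i2 := hK' _ hηv
  have i3 := avg_mono coz (((co.const_mul (3 * M)).add (cηh.const_mul (60 * ε))).add
    (cl.const_mul (990 * L * M)))
    fun p => linOp_cutoff_sq_le hη hv p z (hMp p) hL.1 hL.2.1 hL.2.2.1 hL.2.2.2 (hη' p)
  rw [avg_add_three co cηh cl] at i3
  have n1 : 0 ≤ avg (lowSq v) := avg_nonneg fun p => by unfold lowSq; positivity
  have n2 : 0 ≤ avg (fun p => linOp (a p) (b p) (c p) (d p) v p ^ 2) :=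
    avg_nonneg fun p => sq_nonneg _
  have n3 : 0 ≤ avg (fun p => η p ^ 2 * hessSq v p) :=
    avg_nonneg fun p => by unfold hessSq; positivity
  have i4 := mul_le_mul_of_nonneg_left i3 hK
  have i5 := mul_le_mul_of_nonneg_right hε n3
  have i6 : 0 ≤ (144 * M + 3960 * K * L * M) *
    avg (fun p => linOp (a p) (b p) (c p) (d p) v p ^ 2) := by positivity
  have i7 : 0 ≤ 12 * K * M * avg (lowSq v) := by positivity
  linarith

lemma PerCont.sub_sq_le_of_near_lattice {f : R3 → ℝ} (hf : PerCont f) {δ ε : ℝ}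
    (hδ : ∀ p q : R3, ‖p - q‖ < δ → |f p - f q| ≤ ε) {p z : R3}
    (h : ∃ i j k : ℤ, ‖p + -z - ((i : ℝ), (j : ℝ), (k : ℝ))‖ < δ) : (f z - f p) ^ 2 ≤ ε ^ 2 := by
  obtain ⟨i, j, k, h⟩ := h
  rw [← hf.per.comp_lattice z i j k]
  refine sq_le_sq' ?_ ?_ <;>
    linarith [abs_le.1 (hδ p (z + ((i : ℝ), (j : ℝ), (k : ℝ))) (by rwa [← sub_sub, sub_eq_add_neg p]))]

lemma exists_var_coeff_estimate {a b c d : R3 → ℝ} (ha : PerCont a) (hb : PerCont b)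
    (hc : PerCont c) (hd : PerCont d) {l : ℝ} (hl : 0 < l) (hal : ∀ p, l ≤ a p)
    (hdet : ∀ p, l ≤ a p * b p - c p ^ 2 - d p ^ 2) :
    ∃ K, 0 ≤ K ∧ ∀ v, PerDiff 2 v → avg (hessSq v)
      ≤ K * (avg (fun p => linOp (a p) (b p) (c p) (d p) v p ^ 2) + avg (lowSq v)) := by
  obtain ⟨La, hLa0, hLa⟩ := ha.bounded
  obtain ⟨Lb, hLb0, hLb⟩ := hb.bounded
  obtain ⟨Lc, hLc0, hLc⟩ := hc.bounded
  obtain ⟨Ld, hLd0, hLd⟩ := hd.bounded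
  obtain ⟨L, hL⟩ : ∃ L, L = La + Lb + Lc + Ld := ⟨_, rfl⟩
  have bL : ∀ z, |a z| ≤ L ∧ |b z| ≤ L ∧ |c z| ≤ L ∧ |d z| ≤ L := fun z =>
    ⟨by linarith [hLa z], by linarith [hLb z], by linarith [hLc z], by linarith [hLd z]⟩
  obtain ⟨K, hK, hKe⟩ := exists_const_coeff_estimate l L hl
  obtain ⟨ε, hε⟩ : ∃ ε, ε = Real.sqrt (1 / (240 * (K + 1))) := ⟨_, rfl⟩
  have hε0 : 0 < ε := by rw [hε]; positivity
  have hε2 : 240 * K * ε ^ 2 ≤ 1 := by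
    rw [hε, Real.sq_sqrt (by positivity)]
    field_simp
    linarith
  obtain ⟨δa, pa, ma⟩ := ha.exists_modulus hε0
  obtain ⟨δb, pb, mb⟩ := hb.exists_modulus hε0
  obtain ⟨δc, pc, mc⟩ := hc.exists_modulus hε0
  obtain ⟨δd, hpd, md⟩ := hd.exists_modulus hε0
  obtain ⟨δ, hδ⟩ : ∃ δ, δ = min (min δa δb) (min δc δd) := ⟨_, rfl⟩
  have hδ0 : 0 < δ := by rw [hδ]; exact lt_min (lt_min pa pb) (lt_min pc hpd)
  have hδ' : δ ≤ δa ∧ δ ≤ δb ∧ δ ≤ δc ∧ δ ≤ δd := by rw [hδ]; simp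
  obtain ⟨η, hη, η0, hηs⟩ := exists_cutoff hδ0
  have hloc : ∀ z, ∃ C, 0 ≤ C ∧ ∀ v, PerDiff 2 v → avg (fun p => η (p + -z) ^ 2 * hessSq v p)
      ≤ C * (avg (fun p => linOp (a p) (b p) (c p) (d p) v p ^ 2) + avg (lowSq v)) := fun z => by
    have bz := bL z
    refine local_estimate ha hb hc hd ((hη 2).shift (-z)) hK hε2 z
      (fun v hv => hKe _ _ _ _ (hal z) bz.1 bz.2.2.1 bz.2.2.2 (hdet z) v hv) (L := L ^ 2)
      ⟨sq_le_sq' (abs_le.1 bz.1).1 (abs_le.1 bz.1).2,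
        sq_le_sq' (abs_le.1 bz.2.1).1 (abs_le.1 bz.2.1).2,
        sq_le_sq' (abs_le.1 bz.2.2.1).1 (abs_le.1 bz.2.2.1).2,
        sq_le_sq' (abs_le.1 bz.2.2.2).1 (abs_le.1 bz.2.2.2).2⟩ fun p hp => ?_
    have hs := hηs _ hp
    exact ⟨ha.sub_sq_le_of_near_lattice (fun p q h => ma p q (h.trans_le hδ'.1)) hs,
      hb.sub_sq_le_of_near_lattice (fun p q h => mb p q (h.trans_le hδ'.2.1)) hs,
      hc.sub_sq_le_of_near_lattice (fun p q h => mc p q (h.trans_le hδ'.2.2.1)) hs,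
      hd.sub_sq_le_of_near_lattice (fun p q h => md p q (h.trans_le hδ'.2.2.2)) hs⟩
  choose C hC0 hC using hloc
  obtain ⟨t, ht⟩ := isCompact_univ.elim_finite_subcover
    (fun z : R3 => {θ : UnitAddTorus (Fin 3) | η 0 / 2 < η (torusSec θ + -z)})
    (fun z => isOpen_lt continuous_const ((hη 0).shift (-z)).perCont.continuous_torusSec)
    (fun θ _ => Set.mem_iUnion.2 ⟨torusSec θ, by simp [η0]⟩)
  refine ⟨∑ z ∈ t, (η 0 / 2)⁻¹ ^ 2 * C z, Finset.sum_nonneg fun z _ => mul_nonneg (sq_nonneg _)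
    (hC0 z), fun v hv => ?_⟩
  have ch := PerDiff.hessSq hv
  have hh0 : ∀ p, 0 ≤ hessSq v p := fun p => by unfold hessSq; positivity
  have ci : ∀ z ∈ t, PerCont fun p => (η 0 / 2)⁻¹ ^ 2 * (η (p + -z) ^ 2 * hessSq v p) :=
    fun z _ => (((hη 0).shift (-z)).perCont.sq.mul ch).const_mul _
  have hcov : avg (hessSq v)
      ≤ avg (fun p => ∑ z ∈ t, (η 0 / 2)⁻¹ ^ 2 * (η (p + -z) ^ 2 * hessSq v p)) := by
    refine integral_mono ch.integrable (PerCont.sum t ci).integrable fun θ => ?_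
    obtain ⟨z, hz, hθ⟩ := Set.mem_iUnion₂.1 (ht (Set.mem_univ θ))
    have hpos : 0 < η 0 / 2 := by linarith
    have h1 : 1 ≤ (η 0 / 2)⁻¹ ^ 2 * η (torusSec θ + -z) ^ 2 := by
      rw [← mul_pow]
      refine one_le_pow₀ ?_
      rw [inv_mul_eq_div, one_le_div hpos]
      exact le_of_lt hθ
    refine le_trans ?_ (Finset.single_le_sum
      (f := fun z => (η 0 / 2)⁻¹ ^ 2 * (η (torusSec θ + -z) ^ 2 * hessSq v (torusSec θ)))
      (fun z _ => mul_nonneg (sq_nonneg _) (mul_nonneg (sq_nonneg _) (hh0 _))) hz)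
    simp only
    rw [← mul_assoc]
    exact le_mul_of_one_le_left (hh0 _) h1
  refine hcov.trans ?_
  rw [avg_finset_sum t ci, Finset.sum_mul]
  refine Finset.sum_le_sum fun z _ => ?_
  rw [avg_const_mul, mul_assoc]
  exact mul_le_mul_of_nonneg_left (hC z v hv) (sq_nonneg _)
/-! ### Finite differences -/

/-- The forward difference operator with step `h`. -/
def dl (h : R3) (f : R3 → ℝ) : R3 → ℝ := fun p => f (p + h) - f p

/-- The mean square of a periodic function. -/
def msq (f : R3 → ℝ) : ℝ := avg fun p => f p ^ 2

section Differences
variable {n : ℕ} {f g : R3 → ℝ}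

lemma PerCont.dl (hf : PerCont f) (h : R3) : PerCont (dl h f) := (hf.shift h).sub hf

lemma PerCont.dl_iterate (hf : PerCont f) (h : R3) (m : ℕ) : PerCont ((_root_.dl h)^[m] f) := by
  induction m with
  | zero => exact hf
  | succ m ih => rw [Function.iterate_succ_apply']; exact ih.dl h

lemma PerDiff.dl (hf : PerDiff n f) (h : R3) : PerDiff n (dl h f) := (hf.shift h).sub hf

lemma PerDiff.dl_iterate (hf : PerDiff n f) (h : R3) (m : ℕ) :
    PerDiff n ((_root_.dl h)^[m] f) := by
  induction m with
  | zero => exact hf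
  | succ m ih => rw [Function.iterate_succ_apply']; exact ih.dl h

lemma pd_dl (hf : PerDiff 1 f) (e h : R3) : pd e (dl h f) = dl h (pd e f) := by
  ext p
  unfold dl
  rw [pd_sub e (hf.shift h).differentiable hf.differentiable, pd_shift]

lemma pd_dl_iterate (hf : PerDiff 1 f) (e h : R3) (m : ℕ) :
    pd e ((dl h)^[m] f) = (dl h)^[m] (pd e f) := by
  induction m with
  | zero => rfl
  | succ m ih =>
    rw [Function.iterate_succ_apply', Function.iterate_succ_apply', pd_dl (hf.dl_iterate h m), ih]

lemma dl_iterate_add (h : R3) (m : ℕ) (f g : R3 → ℝ) :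
    (dl h)^[m] (fun p => f p + g p) = fun p => (dl h)^[m] f p + (dl h)^[m] g p := by
  induction m with
  | zero => rfl
  | succ m ih =>
    rw [Function.iterate_succ_apply', Function.iterate_succ_apply', Function.iterate_succ_apply',
      ih]
    ext p; simp only [dl]; ring

lemma dl_iterate_sub (h : R3) (m : ℕ) (f g : R3 → ℝ) :
    (dl h)^[m] (fun p => f p - g p) = fun p => (dl h)^[m] f p - (dl h)^[m] g p := by
  induction m with
  | zero => rfl
  | succ m ih =>
    rw [Function.iterate_succ_apply', Function.iterate_succ_apply', Function.iterate_succ_apply',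
      ih]
    ext p; simp only [dl]; ring

lemma dl_iterate_const (h : R3) (c : ℝ) {m : ℕ} (hm : m ≠ 0) :
    (dl h)^[m] (fun _ => c) = fun _ => 0 := by
  obtain ⟨m, rfl⟩ := Nat.exists_eq_succ_of_ne_zero hm
  induction m with
  | zero => ext p; simp [dl]
  | succ m ih => rw [Function.iterate_succ_apply', ih (by simp)]; ext p; simp [dl]

lemma dl_mul (h : R3) (f g : R3 → ℝ) :
    dl h (fun p => f p * g p)
      = fun p => dl h f p * g p + (f p * dl h g p + dl h f p * dl h g p) := by
  ext p; simp only [dl]; ring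

lemma msq_nonneg (f : R3 → ℝ) : 0 ≤ msq f := avg_nonneg fun _ => sq_nonneg _

lemma msq_add_le (hf : PerCont f) (hg : PerCont g) :
    msq (fun p => f p + g p) ≤ 2 * msq f + 2 * msq g := by
  unfold msq
  rw [← avg_add_two hf.sq hg.sq]
  exact avg_mono (hf.add hg).sq ((hf.sq.const_mul 2).add (hg.sq.const_mul 2))
    fun p => by linarith [sq_nonneg (f p - g p)]

lemma msq_neg (f : R3 → ℝ) : msq (fun p => -f p) = msq f := by
  simp [msq]

lemma msq_sub_le (hf : PerCont f) (hg : PerCont g) :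
    msq (fun p => f p - g p) ≤ 2 * msq f + 2 * msq g := by
  have := msq_add_le hf hg.neg
  rwa [msq_neg] at this

lemma msq_shift (hf : PerCont f) (h : R3) : msq (fun p => f (p + h)) = msq f :=
  avg_shift hf.sq.per h

lemma msq_dl_le (hf : PerCont f) (h : R3) : msq (dl h f) ≤ 4 * msq f := by
  have := msq_sub_le (hf.shift h) hf
  rw [msq_shift hf] at this
  unfold dl
  linarith

lemma msq_mul_le (hf : PerCont f) (hg : PerCont g) {M : ℝ} (hM : ∀ p, |f p| ≤ M) :
    msq (fun p => f p * g p) ≤ M ^ 2 * msq g := by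
  unfold msq
  rw [← avg_const_mul]
  refine avg_mono (hf.mul hg).sq (hg.sq.const_mul _) fun p => ?_
  rw [mul_pow]
  exact mul_le_mul_of_nonneg_right (sq_le_sq' (abs_le.1 (hM p)).1 (abs_le.1 (hM p)).2)
    (sq_nonneg _)

lemma msq_dl_double_le (hf : PerCont f) (h : R3) : msq (dl (h + h) f) ≤ 4 * msq (dl h f) := by
  have h1 : dl (h + h) f = fun p => dl h f (p + h) + dl h f p := by
    ext p; simp only [dl, add_assoc]; ring
  have := msq_add_le ((hf.dl h).shift h) (hf.dl h)
  rw [msq_shift (hf.dl h)] at this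
  rw [h1]; linarith

lemma msq_dl_le_pow (hf : PerCont f) (e : R3) (s : ℝ) (n : ℕ) :
    msq (dl (s • e) f) ≤ 4 ^ n * msq (dl ((s / 2 ^ n) • e) f) := by
  induction n with
  | zero => simp
  | succ n ih =>
    refine ih.trans ?_
    have h1 : (s / 2 ^ n) • e = (s / 2 ^ (n + 1)) • e + (s / 2 ^ (n + 1)) • e := by
      rw [← add_smul]; congr 1; field_simp; ring
    rw [h1, pow_succ (4 : ℝ), mul_assoc]
    exact mul_le_mul_of_nonneg_left (msq_dl_double_le hf _) (by positivity)

lemma msq_dl_smul_le (hf : PerDiff 1 f) (e : R3) {s : ℝ} (hs : 0 < s) :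
    msq (dl (s • e) f) ≤ s ^ 2 * msq (pd e f) := by
  obtain ⟨M, hM0, hM⟩ := (hf.pd e).perCont.bounded
  have h1 : Filter.Tendsto (fun r : ℝ => avg fun p => ((f (p + r • e) - f p) / r) ^ 2)
      (nhdsWithin 0 {0}ᶜ) (nhds (msq (pd e f))) := by
    refine tendsto_avg (M := M ^ 2) (fun r => (hf.perCont.diffQuot e r).sq) ?_
      fun p => (tendsto_diffQuot hf.differentiable e p).pow 2
    filter_upwards [self_mem_nhdsWithin] with r hr p
    rw [abs_pow]
    exact pow_le_pow_left₀ (abs_nonneg _) (abs_diffQuot_le hf.differentiable e hM hr p) 2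
  have h2 : Filter.Tendsto (fun n : ℕ => s / 2 ^ n) Filter.atTop (nhdsWithin 0 {0}ᶜ) := by
    refine tendsto_nhdsWithin_iff.2 ⟨?_, Filter.Eventually.of_forall fun n => by simp [hs.ne']⟩
    have := (tendsto_pow_atTop_nhds_zero_of_lt_one (r := (1 / 2 : ℝ)) (by norm_num)
      (by norm_num)).const_mul s
    rw [mul_zero] at this
    refine this.congr fun n => ?_
    rw [one_div, inv_pow, div_eq_mul_inv]
  refine ge_of_tendsto ((h1.comp h2).const_mul (s ^ 2)) (Filter.Eventually.of_forall fun n => ?_)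
  refine (msq_dl_le_pow hf.perCont e s n).trans_eq ?_
  have h3 : (fun p => ((f (p + (s / 2 ^ n) • e) - f p) / (s / 2 ^ n)) ^ 2)
      = fun p => (4 ^ n / s ^ 2) * dl ((s / 2 ^ n) • e) f p ^ 2 := by
    ext p
    simp only [dl]
    rw [div_pow, div_pow, ← pow_mul, mul_comm n 2, pow_mul]
    norm_num
    field_simp
  simp only [Function.comp]
  rw [h3, avg_const_mul]
  unfold msq
  field_simp

end Differences

/-! ### Orders of smallness of families of functions -/

/-- A family of periodic functions which is `O(s^{kρ})` in mean square, for `0 < s ≤ 1`. -/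
structure L2O (ρ : ℝ) (k : ℕ) (f : ℝ → R3 → ℝ) : Prop where
  perCont : ∀ s, PerCont (f s)
  bound : ∃ C, 0 ≤ C ∧ ∀ s, 0 < s → s ≤ 1 → msq (f s) ≤ C * ((s ^ ρ) ^ k) ^ 2

/-- A family of periodic functions which is uniformly `O(s^{kρ})`, for `0 < s ≤ 1`. -/
structure SupO (ρ : ℝ) (k : ℕ) (f : ℝ → R3 → ℝ) : Prop where
  perCont : ∀ s, PerCont (f s)
  bound : ∃ C, 0 ≤ C ∧ ∀ s, 0 < s → s ≤ 1 → ∀ p, |f s p| ≤ C * (s ^ ρ) ^ k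

section Orders
variable {ρ : ℝ} {k l : ℕ} {f g : ℝ → R3 → ℝ}

lemma L2O.add (hf : L2O ρ k f) (hg : L2O ρ k g) : L2O ρ k (fun s p => f s p + g s p) := by
  obtain ⟨C, hC, hf'⟩ := hf.bound
  obtain ⟨D, hD, hg'⟩ := hg.bound
  refine ⟨fun s => (hf.perCont s).add (hg.perCont s), 2 * C + 2 * D, by positivity,
    fun s h0 h1 => (msq_add_le (hf.perCont s) (hg.perCont s)).trans ?_⟩
  linarith [hf' s h0 h1, hg' s h0 h1]

lemma L2O.neg (hf : L2O ρ k f) : L2O ρ k (fun s p => -f s p) :=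
  ⟨fun s => (hf.perCont s).neg, by simpa only [msq_neg] using hf.bound⟩

lemma L2O.sub (hf : L2O ρ k f) (hg : L2O ρ k g) : L2O ρ k (fun s p => f s p - g s p) := by
  simpa only [sub_eq_add_neg] using hf.add hg.neg

lemma SupO.mul (hf : SupO ρ k f) (hg : L2O ρ l g) :
    L2O ρ (k + l) (fun s p => f s p * g s p) := by
  obtain ⟨C, hC, hf'⟩ := hf.bound
  obtain ⟨D, hD, hg'⟩ := hg.bound
  refine ⟨fun s => (hf.perCont s).mul (hg.perCont s), C ^ 2 * D, by positivity,
    fun s h0 h1 => (msq_mul_le (hf.perCont s) (hg.perCont s) (hf' s h0 h1)).trans ?_⟩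
  calc (C * (s ^ ρ) ^ k) ^ 2 * msq (g s)
      ≤ (C * (s ^ ρ) ^ k) ^ 2 * (D * ((s ^ ρ) ^ l) ^ 2) := by
        gcongr; exact hg' s h0 h1
    _ = _ := by rw [pow_add]; ring

lemma L2O.dl (hf : L2O ρ k f) (e : R3) : L2O ρ k (fun s => dl (s • e) (f s)) := by
  obtain ⟨C, hC, hf'⟩ := hf.bound
  refine ⟨fun s => (hf.perCont s).dl _, 4 * C, by positivity,
    fun s h0 h1 => (msq_dl_le (hf.perCont s) _).trans ?_⟩
  linarith [hf' s h0 h1]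

lemma L2O.dl_iterate (hf : L2O ρ k f) (e : R3) (m : ℕ) :
    L2O ρ k (fun s => (_root_.dl (s • e))^[m] (f s)) := by
  induction m with
  | zero => exact hf
  | succ m ih => simpa only [Function.iterate_succ_apply'] using ih.dl e

lemma SupO.dl (hf : SupO ρ k f) (e : R3) : SupO ρ k (fun s => dl (s • e) (f s)) := by
  obtain ⟨C, hC, hf'⟩ := hf.bound
  refine ⟨fun s => (hf.perCont s).dl _, 2 * C, by positivity, fun s h0 h1 p => ?_⟩
  refine (abs_sub _ _).trans ?_
  linarith [hf' s h0 h1 p, hf' s h0 h1 (p + s • e)]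

lemma SupO.dl_iterate (hf : SupO ρ k f) (e : R3) (m : ℕ) :
    SupO ρ k (fun s => (_root_.dl (s • e))^[m] (f s)) := by
  induction m with
  | zero => exact hf
  | succ m ih => simpa only [Function.iterate_succ_apply'] using ih.dl e

lemma SupO.l2O (hf : SupO ρ k f) : L2O ρ k f := by
  obtain ⟨C, hC, hf'⟩ := hf.bound
  refine ⟨hf.perCont, C ^ 2, by positivity, fun s h0 h1 => ?_⟩
  have h := msq_mul_le (hf.perCont s) (PerCont.const 1) (hf' s h0 h1)
  simp only [mul_one] at h
  refine h.trans_eq ?_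
  simp [msq, avg_const, mul_pow]

lemma PerCont.supO {a : R3 → ℝ} (ha : PerCont a) : SupO ρ 0 (fun _ => a) := by
  obtain ⟨M, h0, hM⟩ := ha.bounded
  exact ⟨fun _ => ha, M, h0, fun s _ _ p => by simpa using hM p⟩

lemma L2O.dl_of_pd {f : ℝ → R3 → ℝ} (hρ : ρ ≤ 1) (e : R3) (hf : ∀ s, PerDiff 1 (f s))
    (h : L2O ρ k (fun s => pd e (f s))) : L2O ρ (k + 1) (fun s => _root_.dl (s • e) (f s)) := by
  obtain ⟨C, hC, h'⟩ := h.bound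
  refine ⟨fun s => (hf s).perCont.dl _, C, hC,
    fun s h0 h1 => (msq_dl_smul_le (hf s) e h0).trans ?_⟩
  have hs : s ≤ s ^ ρ := by
    simpa using Real.rpow_le_rpow_of_exponent_ge h0 h1 hρ
  calc s ^ 2 * msq (pd e (f s)) ≤ (s ^ ρ) ^ 2 * (C * ((s ^ ρ) ^ k) ^ 2) := by
        gcongr
        exacts [msq_nonneg _, h' s h0 h1]
    _ = _ := by ring

end Orders

/-- Differences of smooth functions. -/
lemma l2O_dl_iterate_of_smooth {ρ : ℝ} (hρ : ρ ≤ 1) (e : R3) (m : ℕ) {G : R3 → ℝ}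
    (hG : ∀ n, PerDiff n G) : L2O ρ m (fun s => (dl (s • e))^[m] G) := by
  induction m generalizing G with
  | zero => exact (hG 0).perCont.supO.l2O
  | succ m ih =>
    simp only [Function.iterate_succ_apply']
    refine L2O.dl_of_pd hρ e (fun s => (hG 1).dl_iterate _ m) ?_
    simp only [pd_dl_iterate (hG 1)]
    exact ih fun n => (hG (n + 1)).pd e

lemma l2O_dl_iterate_of_smooth_of_le {ρ : ℝ} (hρ : ρ ≤ 1) (e : R3) {m N : ℕ} (hm : m ≤ N)
    {G : R3 → ℝ} (hG : ∀ n, PerDiff n G) : L2O ρ m (fun s => (dl (s • e))^[N] G) := by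
  obtain ⟨j, rfl⟩ := Nat.exists_eq_add_of_le' hm
  simpa only [Function.iterate_add_apply] using
    (l2O_dl_iterate_of_smooth hρ e m hG).dl_iterate e j

/-- A Hölder continuous function whose high differences are small in mean square. -/
structure Good (ρ : ℝ) (e : R3) (k : ℕ) (a : R3 → ℝ) : Prop where
  perCont : PerCont a
  holder : SupO ρ 1 (fun s => dl (s • e) a)
  small : ∀ m, 2 ^ k ≤ m → L2O ρ k (fun s => (dl (s • e))^[m] a)

section Leibniz
variable {ρ : ℝ} {e : R3} {k : ℕ} {a b : R3 → ℝ}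

lemma SupO.add {l : ℕ} {f g : ℝ → R3 → ℝ} (hf : SupO ρ l f) (hg : SupO ρ l g) :
    SupO ρ l (fun s p => f s p + g s p) := by
  obtain ⟨C, hC, hf'⟩ := hf.bound
  obtain ⟨D, hD, hg'⟩ := hg.bound
  refine ⟨fun s => (hf.perCont s).add (hg.perCont s), C + D, by positivity,
    fun s h0 h1 p => (abs_add_le _ _).trans ?_⟩
  linarith [hf' s h0 h1 p, hg' s h0 h1 p]

lemma Good.add (ha : Good ρ e k a) (hb : Good ρ e k b) : Good ρ e k (fun p => a p + b p) := by
  refine ⟨ha.perCont.add hb.perCont, ?_, fun m hm => ?_⟩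
  · have := ha.holder.add hb.holder
    refine ⟨fun s => (ha.perCont.add hb.perCont).dl _, ?_⟩
    obtain ⟨C, hC, h⟩ := this.bound
    refine ⟨C, hC, fun s h0 h1 p => ?_⟩
    have := h s h0 h1 p
    unfold dl at this ⊢
    convert this using 2
    ring
  · simp only [dl_iterate_add]
    exact (ha.small m hm).add (hb.small m hm)

lemma Good.const (c : ℝ) : Good ρ e k (fun _ => c) := by
  refine ⟨PerCont.const c, ⟨fun s => (PerCont.const c).dl _, 0, le_rfl, by simp [dl]⟩,
    fun m hm => ?_⟩
  have hm0 : m ≠ 0 := by have := Nat.one_le_two_pow (n := k); omega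
  simp only [dl_iterate_const _ c hm0]
  exact ⟨fun _ => PerCont.const 0, 0, le_rfl, by simp [msq, avg_const]⟩

lemma Good.holder_iterate (ha : Good ρ e k a) {m : ℕ} (hm : 1 ≤ m) :
    SupO ρ 1 (fun s => (dl (s • e))^[m] a) := by
  obtain ⟨j, rfl⟩ := Nat.exists_eq_add_of_le' hm
  simpa only [Function.iterate_add_apply, Function.iterate_one] using ha.holder.dl_iterate e j

lemma Good.dl_iterate_mul (ha : Good ρ e k a) (hb : Good ρ e k b) (n : ℕ) {i j : ℕ} (hi : 1 ≤ i)
    (hj : 1 ≤ j) (h : 2 ^ (k + 1) ≤ n + i + j) :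
    L2O ρ (k + 1) (fun s => (dl (s • e))^[n] fun p =>
      (dl (s • e))^[i] a p * (dl (s • e))^[j] b p) := by
  induction n generalizing i j with
  | zero =>
    simp only [Function.iterate_zero, id]
    rw [add_comm k 1]
    have h2 : 2 ^ (k + 1) = 2 ^ k + 2 ^ k := by ring
    rcases le_or_gt (2 ^ k) j with hj' | hj'
    · exact (ha.holder_iterate hi).mul (hb.small j hj')
    · have hi' : 2 ^ k ≤ i := by omega
      simpa only [mul_comm] using (hb.holder_iterate hj).mul (ha.small i hi')
  | succ n ih =>
    simp only [Function.iterate_succ_apply, dl_mul, dl_iterate_add]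
    simp only [← Function.iterate_succ_apply' (dl _)]
    exact (ih (by omega) hj (by omega)).add ((ih hi (by omega) (by omega)).add
      (ih (by omega) (by omega) (by omega)))

lemma Good.dl_iterate_leibniz_aux (ha : Good ρ e k a) (hb : Good ρ e k b) {n : ℕ} (hn : 1 ≤ n)
    (m : ℕ) (h : 2 ^ (k + 1) ≤ m + n) :
    L2O ρ (k + 1) (fun s => (dl (s • e))^[m] fun p => (dl (s • e))^[n] (fun q => a q * b q) p
      - (a p * (dl (s • e))^[n] b p + b p * (dl (s • e))^[n] a p)) := by
  induction n, hn using Nat.le_induction generalizing m with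
  | base =>
    convert ha.dl_iterate_mul hb m (le_refl 1) (le_refl 1) (by omega) using 4 with s p
    simp only [Function.iterate_one, dl]; ring
  | succ n hn ih =>
    have key : ∀ s : ℝ, (fun p => (dl (s • e))^[n + 1] (fun q => a q * b q) p
        - (a p * (dl (s • e))^[n + 1] b p + b p * (dl (s • e))^[n + 1] a p))
        = fun p => dl (s • e) (fun p => (dl (s • e))^[n] (fun q => a q * b q) p
          - (a p * (dl (s • e))^[n] b p + b p * (dl (s • e))^[n] a p)) p
          + (((dl (s • e))^[1] a p * (dl (s • e))^[n] b p
            + (dl (s • e))^[1] a p * (dl (s • e))^[n + 1] b p)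
          + ((dl (s • e))^[n] a p * (dl (s • e))^[1] b p
            + (dl (s • e))^[n + 1] a p * (dl (s • e))^[1] b p)) := fun s => by
      ext p
      simp only [Function.iterate_succ_apply' (dl _) n, Function.iterate_one]
      simp only [dl]; ring
    simp only [key, dl_iterate_add, ← Function.iterate_succ_apply (dl _) m]
    exact (ih (m + 1) (by omega)).add
      (((ha.dl_iterate_mul hb m le_rfl hn (by omega)).add
        (ha.dl_iterate_mul hb m le_rfl (by omega) (by omega))).add
      ((ha.dl_iterate_mul hb m hn le_rfl (by omega)).add
        (ha.dl_iterate_mul hb m (by omega) le_rfl (by omega))))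

lemma Good.dl_iterate_leibniz (ha : Good ρ e k a) (hb : Good ρ e k b) {N : ℕ}
    (h : 2 ^ (k + 1) ≤ N) :
    L2O ρ (k + 1) (fun s p => (dl (s • e))^[N] (fun q => a q * b q) p
      - (a p * (dl (s • e))^[N] b p + b p * (dl (s • e))^[N] a p)) :=
  ha.dl_iterate_leibniz_aux hb (Nat.one_le_two_pow.trans h) 0 (by omega)

end Leibniz
/-! ### Bootstrapping the smallness of high differences of a solution -/

/-- The coordinate directions. -/
def dirs : Set R3 := {vx, vy, vt}

lemma vx_mem_dirs : vx ∈ dirs := Or.inl rfl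
lemma vy_mem_dirs : vy ∈ dirs := Or.inr (Or.inl rfl)
lemma vt_mem_dirs : vt ∈ dirs := Or.inr (Or.inr rfl)

/-- Smallness in mean square of the differences, of order at least `2 ^ k`, of a function and its
derivatives of order at most two. -/
structure SmallDiff (ρ : ℝ) (e : R3) (k : ℕ) (u : R3 → ℝ) : Prop where
  zero : ∀ m, 2 ^ k ≤ m → L2O ρ k (fun s => (dl (s • e))^[m] u)
  one : ∀ i ∈ dirs, ∀ m, 2 ^ k ≤ m → L2O ρ k (fun s => (dl (s • e))^[m] (pd i u))
  two : ∀ i ∈ dirs, ∀ j ∈ dirs, ∀ m, 2 ^ k ≤ m →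
    L2O ρ k (fun s => (dl (s • e))^[m] (pd j (pd i u)))

section Bootstrap
variable {ρ : ℝ} {e : R3} {k : ℕ} {u G : R3 → ℝ}

lemma smallDiff_zero (hu : PerDiff 2 u) : SmallDiff ρ e 0 u where
  zero m _ := hu.perCont.supO.l2O.dl_iterate e m
  one i _ m _ := (hu.pd i).perCont.supO.l2O.dl_iterate e m
  two i _ j _ m _ := ((hu.pd i).pd j).perCont.supO.l2O.dl_iterate e m

lemma L2O.succ_of_pd {f : R3 → ℝ} (hρ : ρ ≤ 1) (hf : PerDiff 1 f)
    (h : ∀ m, 2 ^ k ≤ m → L2O ρ k (fun s => (_root_.dl (s • e))^[m] (pd e f))) (m : ℕ)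
    (hm : 2 ^ (k + 1) ≤ m) : L2O ρ (k + 1) (fun s => (_root_.dl (s • e))^[m] f) := by
  have h2 : 2 ^ (k + 1) = 2 ^ k + 2 ^ k := by ring
  have h3 := Nat.one_le_two_pow (n := k)
  obtain ⟨m, rfl⟩ : ∃ j, m = j + 1 := ⟨m - 1, by omega⟩
  simp only [Function.iterate_succ_apply']
  refine L2O.dl_of_pd hρ e (fun s => hf.dl_iterate _ m) ?_
  simp only [pd_dl_iterate hf]
  exact h m (by omega)

lemma PerDiff.supO_dl {f : R3 → ℝ} (hρ : ρ ≤ 1) (hf : PerDiff 1 f) :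
    SupO ρ 1 (fun s => _root_.dl (s • e) f) := by
  obtain ⟨M, hM0, hM⟩ := (hf.pd e).perCont.bounded
  refine ⟨fun s => hf.perCont.dl _, M, hM0, fun s h0 h1 p => ?_⟩
  refine (abs_sub_line_le hf.differentiable e hM p s).trans ?_
  rw [abs_of_pos h0, pow_one]
  gcongr
  simpa using Real.rpow_le_rpow_of_exponent_ge h0 h1 hρ

lemma pd_pd_dl_iterate (hu : PerDiff 2 u) (i j h : R3) (m : ℕ) :
    pd j (pd i ((dl h)^[m] u)) = (dl h)^[m] (pd j (pd i u)) := by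
  rw [pd_dl_iterate (hu.of_le (by norm_num)), pd_dl_iterate (hu.pd i)]

lemma avg_lowSq {v : R3 → ℝ} (hv : PerDiff 1 v) :
    avg (lowSq v) = msq v + msq (pd vx v) + msq (pd vy v) + msq (pd vt v) := by
  have h := fun i => (hv.pd i).perCont.sq
  unfold lowSq msq
  rw [avg_add ((hv.perCont.sq.add (h vx)).add (h vy)) (h vt),
    avg_add (hv.perCont.sq.add (h vx)) (h vy), avg_add hv.perCont.sq (h vx)]

lemma msq_pd_pd_le {v : R3 → ℝ} (hv : PerDiff 2 v) {i j : R3} (hi : i ∈ dirs) (hj : j ∈ dirs) :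
    msq (pd j (pd i v)) ≤ avg (hessSq v) := by
  refine avg_mono ((hv.pd i).pd j).perCont.sq hv.hessSq fun p => ?_
  have h : pd j (pd i v) p = pd i (pd j v) p := pd_comm hv.diff j i p
  unfold _root_.hessSq
  rcases hi with rfl | rfl | rfl <;> rcases hj with rfl | rfl | rfl <;>
    first
    | nlinarith [sq_nonneg (pd vx (pd vx v) p), sq_nonneg (pd vy (pd vx v) p),
      sq_nonneg (pd vt (pd vx v) p), sq_nonneg (pd vy (pd vy v) p), sq_nonneg (pd vt (pd vy v) p),
      sq_nonneg (pd vt (pd vt v) p)]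
    | (rw [h]; nlinarith [sq_nonneg (pd vx (pd vx v) p), sq_nonneg (pd vy (pd vx v) p),
      sq_nonneg (pd vt (pd vx v) p), sq_nonneg (pd vy (pd vy v) p), sq_nonneg (pd vt (pd vy v) p),
      sq_nonneg (pd vt (pd vt v) p)])

lemma SmallDiff.succ (hρ : ρ ≤ 1) (he : e ∈ dirs) (hu : PerDiff 2 u) (hG : ∀ n, PerDiff n G)
    (hGpos : ∀ p, 0 < G p)
    (heq : ∀ p, (pd vx (pd vx u) p + 1)
        * (pd vy (pd vy u) p + pd vt (pd vt u) p + pd vt u p + 1)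
      - (pd vy (pd vx u) p) ^ 2 - (pd vt (pd vx u) p) ^ 2 = G p)
    (hpos : ∀ p, 0 < pd vx (pd vx u) p + 1)
    (hH : ∀ i ∈ dirs, ∀ j ∈ dirs, SupO ρ 1 (fun s => dl (s • e) (pd j (pd i u))))
    (h : SmallDiff ρ e k u) : SmallDiff ρ e (k + 1) u := by
  have hu1 : PerDiff 1 u := hu.of_le (by norm_num)
  have hzero := L2O.succ_of_pd hρ hu1 (h.one e he)
  have hone : ∀ i ∈ dirs, ∀ m, 2 ^ (k + 1) ≤ m →
      L2O ρ (k + 1) (fun s => (dl (s • e))^[m] (pd i u)) :=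
    fun i hi => L2O.succ_of_pd hρ (hu.pd i) (h.two i hi e he)
  refine ⟨hzero, hone, fun i hi j hj N hN => ?_⟩
  have hN0 : N ≠ 0 := by have := Nat.one_le_two_pow (n := k + 1); omega
  have g2 : ∀ i ∈ dirs, ∀ j ∈ dirs, Good ρ e k (pd j (pd i u)) := fun i hi j hj =>
    ⟨((hu.pd i).pd j).perCont, hH i hi j hj, h.two i hi j hj⟩
  have g1 : Good ρ e k (pd vt u) :=
    ⟨(hu.pd vt).perCont, (hu.pd vt).supO_dl hρ, h.one vt vt_mem_dirs⟩
  have gA := (g2 vx vx_mem_dirs vx vx_mem_dirs).add (Good.const 1)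
  have gB := (((g2 vy vy_mem_dirs vy vy_mem_dirs).add (g2 vt vt_mem_dirs vt vt_mem_dirs)).add
    g1).add (Good.const 1)
  have gC := g2 vx vx_mem_dirs vy vy_mem_dirs
  have gD := g2 vx vx_mem_dirs vt vt_mem_dirs
  obtain ⟨l1, hl1, hl1'⟩ := gA.perCont.lower_bound hpos
  obtain ⟨l2, hl2, hl2'⟩ := (hG 0).perCont.lower_bound hGpos
  obtain ⟨K, hK0, hK⟩ := exists_var_coeff_estimate gA.perCont gB.perCont gC.perCont gD.perCont
    (l := min l1 l2) (lt_min hl1 hl2) (fun p => (min_le_left _ _).trans (hl1' p))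
    (fun p => (min_le_right _ _).trans ((hl2' p).trans_eq (heq p).symm))
  have hG' : G = fun p => ((pd vx (pd vx u) p + 1)
        * (pd vy (pd vy u) p + pd vt (pd vt u) p + pd vt u p + 1)
      - pd vy (pd vx u) p * pd vy (pd vx u) p) - pd vt (pd vx u) p * pd vt (pd vx u) p := by
    ext p; rw [← heq p]; ring
  have hlin : L2O ρ (k + 1) (fun s p => linOp (pd vx (pd vx u) p + 1)
      (pd vy (pd vy u) p + pd vt (pd vt u) p + pd vt u p + 1) (pd vy (pd vx u) p)
      (pd vt (pd vx u) p) ((dl (s • e))^[N] u) p) := by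
    have o1 := l2O_dl_iterate_of_smooth_of_le hρ e
      ((Nat.lt_two_pow_self (n := k + 1)).le.trans hN) hG
    have o2 := gA.perCont.supO.mul (hone vt vt_mem_dirs N hN)
    rw [zero_add] at o2
    have o3 := ((gA.dl_iterate_leibniz gB hN).sub (gC.dl_iterate_leibniz gC hN)).sub
      (gD.dl_iterate_leibniz gD hN)
    convert (o1.sub o2).sub o3 using 3 with s p
    unfold linOp
    simp only [pd_pd_dl_iterate hu]
    rw [hG']
    simp only [dl_iterate_sub, dl_iterate_add, dl_iterate_const _ _ hN0]
    ring
  obtain ⟨C0, c0, b0⟩ := hlin.bound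
  obtain ⟨C1, c1, b1⟩ := (hzero N hN).bound
  obtain ⟨C2, c2, b2⟩ := (hone vx vx_mem_dirs N hN).bound
  obtain ⟨C3, c3, b3⟩ := (hone vy vy_mem_dirs N hN).bound
  obtain ⟨C4, c4, b4⟩ := (hone vt vt_mem_dirs N hN).bound
  refine ⟨fun s => ((hu.pd i).pd j).perCont.dl_iterate _ N, K * (C0 + C1 + C2 + C3 + C4),
    by positivity, fun s h0 h1 => ?_⟩
  have hv := hu.dl_iterate (s • e) N
  rw [← pd_pd_dl_iterate hu]
  refine (msq_pd_pd_le hv hi hj).trans ((hK _ hv).trans ?_)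
  rw [avg_lowSq (hv.of_le (by norm_num)), mul_assoc K]
  simp only [pd_dl_iterate hu1]
  refine mul_le_mul_of_nonneg_left ?_ hK0
  have := b0 s h0 h1
  rw [msq] at this
  linarith [b1 s h0 h1, b2 s h0 h1, b3 s h0 h1, b4 s h0 h1]

/-- Solutions are elliptic. -/
lemma pd_vx_pd_vx_add_one_pos (hu : PerDiff 2 u) (hGpos : ∀ p, 0 < G p)
    (heq : ∀ p, (pd vx (pd vx u) p + 1)
        * (pd vy (pd vy u) p + pd vt (pd vt u) p + pd vt u p + 1)
      - (pd vy (pd vx u) p) ^ 2 - (pd vt (pd vx u) p) ^ 2 = G p) (p : R3) :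
    0 < pd vx (pd vx u) p + 1 := by
  have hA : PerCont fun p => pd vx (pd vx u) p + 1 :=
    ((hu.pd vx).pd vx).perCont.add (PerCont.const 1)
  have hne : ∀ p, pd vx (pd vx u) p + 1 ≠ 0 := fun p h0 => by
    have := heq p
    rw [h0] at this
    nlinarith [hGpos p, sq_nonneg (pd vy (pd vx u) p), sq_nonneg (pd vt (pd vx u) p)]
  have havg : avg (fun p => pd vx (pd vx u) p + 1) = 1 := by
    have h1 := avg_mul_pd (hu.pd vx) (PerDiff.const 1) vx
    have h2 : pd vx (fun _ : R3 => (1 : ℝ)) = fun _ => 0 := by ext p; simp [pd]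
    simp only [one_mul, h2, mul_zero, avg_const, neg_zero] at h1
    rw [avg_add ((hu.pd vx).pd vx).perCont (PerCont.const 1), h1, avg_const, zero_add]
  obtain ⟨q, hq⟩ : ∃ q, 0 < pd vx (pd vx u) q + 1 := by
    by_contra! hcon
    have := avg_mono hA (PerCont.const 0) hcon
    rw [havg, avg_const] at this
    norm_num at this
  by_contra! hp
  obtain ⟨r, hr⟩ := mem_range_of_exists_le_of_exists_ge hA.cont ⟨p, hp⟩ ⟨q, hq.le⟩
  exact hne r hr

lemma smallDiff_of_solution (hρ : ρ ≤ 1) (hu : PerDiff 2 u) (hG : ∀ n, PerDiff n G)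
    (hGpos : ∀ p, 0 < G p)
    (heq : ∀ p, (pd vx (pd vx u) p + 1)
        * (pd vy (pd vy u) p + pd vt (pd vt u) p + pd vt u p + 1)
      - (pd vy (pd vx u) p) ^ 2 - (pd vt (pd vx u) p) ^ 2 = G p)
    (hH : ∀ e ∈ dirs, ∀ i ∈ dirs, ∀ j ∈ dirs, SupO ρ 1 (fun s => dl (s • e) (pd j (pd i u))))
    (he : e ∈ dirs) (k : ℕ) : SmallDiff ρ e k u := by
  induction k with
  | zero => exact smallDiff_zero hu
  | succ k ih =>
    exact ih.succ hρ he hu hG hGpos heq (pd_vx_pd_vx_add_one_pos hu hGpos heq) (hH e he)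

end Bootstrap
/-! ### Fourier coefficients -/

section Fourier
open UnitAddTorus

lemma mFourier_apply_add (n : Fin 3 → ℤ) (x y : UnitAddTorus (Fin 3)) :
    mFourier n (x + y) = mFourier n x * mFourier n y := by
  simp only [mFourier, ContinuousMap.coe_mk, ← Finset.prod_mul_distrib]
  refine Finset.prod_congr rfl fun i _ => ?_
  simp only [fourier_apply, Pi.add_apply, smul_add, AddCircle.toCircle_add, Circle.coe_mul]

lemma norm_mFourier_apply (n : Fin 3 → ℤ) (x : UnitAddTorus (Fin 3)) : ‖mFourier n x‖ = 1 := by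
  simp only [mFourier, ContinuousMap.coe_mk, norm_prod, fourier_apply, Circle.norm_coe,
    Finset.prod_const_one]

lemma mFourier_toTorus (n : Fin 3 → ℤ) (p : R3) : mFourier n (toTorus p)
    = Complex.exp ((2 * Real.pi * (n 0 * p.1 + n 1 * p.2.1 + n 2 * p.2.2) : ℝ) * Complex.I) := by
  simp only [mFourier, ContinuousMap.coe_mk, Fin.prod_univ_three, toTorus, Matrix.cons_val_zero,
    Matrix.cons_val_one, Matrix.cons_val, fourier_coe_apply]
  rw [← Complex.exp_add, ← Complex.exp_add]
  congr 1
  push_cast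
  ring

/-- The Fourier coefficients of a periodic function. -/
def cf (f : R3 → ℝ) (n : Fin 3 → ℤ) : ℂ :=
  ∫ θ, mFourier (-n) θ * (f (torusSec θ) : ℂ) ∂torusMeasure

variable {f u : R3 → ℝ}

lemma PerCont.integrable_mFourier_mul (hf : PerCont f) (n : Fin 3 → ℤ) :
    Integrable (fun θ => mFourier n θ * (f (torusSec θ) : ℂ)) torusMeasure :=
  ((mFourier n).continuous.mul (Complex.continuous_ofReal.comp
    hf.continuous_torusSec)).integrable_of_hasCompactSupport (HasCompactSupport.of_compactSpace _)

lemma cf_shift (hf : PerCont f) (h : R3) (n : Fin 3 → ℤ) :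
    cf (fun p => f (p + h)) n = mFourier n (toTorus h) * cf f n := by
  have h1 : ∀ θ, mFourier (-n) θ * (f (torusSec θ + h) : ℂ) = mFourier n (toTorus h) *
      (mFourier (-n) (θ + toTorus h) * (f (torusSec (θ + toTorus h)) : ℂ)) := fun θ => by
    have h2 : mFourier n (toTorus h) * mFourier (-n) (toTorus h) = 1 := by
      rw [← mFourier_add, add_neg_cancel, mFourier_zero]; rfl
    rw [hf.per.apply_torusSec_add, mFourier_apply_add]
    linear_combination (-(mFourier (-n) θ * (f (torusSec θ + h) : ℂ))) * h2
  unfold cf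
  simp only [h1]
  rw [integral_const_mul, integral_add_right_eq_self
    (fun θ => mFourier (-n) θ * (f (torusSec θ) : ℂ)) (toTorus h)]

lemma cf_dl (hf : PerCont f) (h : R3) (n : Fin 3 → ℤ) :
    cf (dl h f) n = (mFourier n (toTorus h) - 1) * cf f n := by
  have h1 : cf (dl h f) n = cf (fun p => f (p + h)) n - cf f n := by
    unfold cf
    rw [← integral_sub ((hf.shift h).integrable_mFourier_mul _) (hf.integrable_mFourier_mul _)]
    congr 1; ext θ; simp only [dl]; push_cast; ring
  rw [h1, cf_shift hf]; ring

lemma cf_dl_iterate (hf : PerCont f) (h : R3) (n : Fin 3 → ℤ) (m : ℕ) :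
    cf ((dl h)^[m] f) n = (mFourier n (toTorus h) - 1) ^ m * cf f n := by
  induction m with
  | zero => simp
  | succ m ih => rw [Function.iterate_succ_apply', cf_dl (hf.dl_iterate h m), ih]; ring

lemma norm_cf_sq_le (hf : PerCont f) (n : Fin 3 → ℤ) : ‖cf f n‖ ^ 2 ≤ msq f := by
  have habs : PerCont fun p => |f p| := ⟨fun p => by simp [hf.per p], hf.cont.abs⟩
  have h1 : ‖cf f n‖ ≤ avg fun p => |f p| := by
    refine (norm_integral_le_integral_norm _).trans_eq ?_
    simp [norm_mFourier_apply, avg]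
  have h2 : (avg fun p => |f p|) ^ 2 ≤ msq f := by
    obtain ⟨a, ha⟩ : ∃ a, a = avg fun p => |f p| := ⟨_, rfl⟩
    have h3 : 0 ≤ avg fun p => (1 * f p ^ 2 + (-2 * a) * |f p|) + a ^ 2 :=
      avg_nonneg fun p => by nlinarith [sq_nonneg (|f p| - a), sq_abs (f p)]
    rw [avg_add ((hf.sq.const_mul 1).add (habs.const_mul _)) (PerCont.const _),
      avg_add_two hf.sq habs, avg_const, ← ha] at h3
    rw [← ha, msq]
    linarith
  exact (pow_le_pow_left₀ (norm_nonneg _) h1 2).trans h2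

lemma norm_cf_le_of_dl_iterate (hf : PerCont f) {h : R3} {n : Fin 3 → ℤ}
    (hh : mFourier n (toTorus h) = -1) (m : ℕ) : ‖cf f n‖ ^ 2 ≤ msq ((dl h)^[m] f) := by
  refine le_trans ?_ (norm_cf_sq_le (hf.dl_iterate h m) n)
  rw [cf_dl_iterate hf, hh, norm_mul, norm_pow, show ‖(-1 - 1 : ℂ)‖ = 2 by norm_num]
  refine pow_le_pow_left₀ (norm_nonneg _) ?_ 2
  exact le_mul_of_one_le_left (norm_nonneg _) (one_le_pow₀ (by norm_num))

lemma exp_half_period {n : ℤ} (hn : n ≠ 0) :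
    Complex.exp ((2 * Real.pi * (n * (1 / (2 * |(n : ℝ)|))) : ℝ) * Complex.I) = -1 := by
  have hn' : (n : ℝ) ≠ 0 := by exact_mod_cast hn
  rcases abs_cases (n : ℝ) with ⟨h, -⟩ | ⟨h, -⟩
  · rw [h, show 2 * Real.pi * (n * (1 / (2 * (n : ℝ)))) = Real.pi by field_simp]
    exact Complex.exp_pi_mul_I
  · rw [h, show 2 * Real.pi * (n * (1 / (2 * -(n : ℝ)))) = -Real.pi by field_simp]
    push_cast
    rw [neg_mul, Complex.exp_neg, Complex.exp_pi_mul_I]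
    norm_num

lemma exists_dir_mFourier_eq {n : Fin 3 → ℤ} (hn : n ≠ 0) : ∃ e ∈ dirs,
    1 ≤ ‖n‖ ∧ mFourier n (toTorus ((1 / (2 * ‖n‖)) • e)) = -1 := by
  obtain ⟨i, hi⟩ : ∃ i, ‖n i‖ = ‖n‖ := by
    obtain ⟨i, -, hi⟩ := Finset.exists_max_image Finset.univ (fun i => ‖n i‖)
      Finset.univ_nonempty
    exact ⟨i, le_antisymm (norm_le_pi_norm n i)
      ((pi_norm_le_iff_of_nonneg (norm_nonneg _)).2 fun j => hi j (Finset.mem_univ j))⟩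
  have hni : n i ≠ 0 := fun h0 => hn (by
    rw [h0, norm_zero] at hi
    exact norm_eq_zero.1 hi.symm)
  have h1 : 1 ≤ ‖n i‖ := by
    rw [Int.norm_eq_abs]
    exact_mod_cast Int.one_le_abs hni
  rw [← hi]
  rw [Int.norm_eq_abs] at h1 ⊢
  fin_cases i
  · refine ⟨vx, vx_mem_dirs, h1, ?_⟩
    rw [mFourier_toTorus, ← exp_half_period hni]
    simp [vx]
  · refine ⟨vy, vy_mem_dirs, h1, ?_⟩
    rw [mFourier_toTorus, ← exp_half_period hni]
    simp [vy]
  · refine ⟨vt, vt_mem_dirs, h1, ?_⟩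
    rw [mFourier_toTorus, ← exp_half_period hni]
    simp [vt]

/-- Rapid decay of the Fourier coefficients. -/
lemma exists_norm_cf_mul_le {ρ : ℝ} (hρ : 0 < ρ) (hu : PerCont u)
    (h : ∀ e ∈ dirs, ∀ k, ∃ m, L2O ρ k (fun s => (dl (s • e))^[m] u)) (K : ℕ) :
    ∃ C, 0 ≤ C ∧ ∀ n, ‖cf u n‖ * (1 + ‖n‖) ^ K ≤ C := by
  obtain ⟨k, hk⟩ := exists_nat_ge ((K : ℝ) / ρ)
  rw [div_le_iff₀ hρ] at hk
  have hdir : ∀ e ∈ dirs, ∃ C, 0 ≤ C ∧ ∀ n : Fin 3 → ℤ, 1 ≤ ‖n‖ →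
      mFourier n (toTorus ((1 / (2 * ‖n‖)) • e)) = -1 → ‖cf u n‖ * (1 + ‖n‖) ^ K ≤ C := by
    intro e he
    obtain ⟨m, hm⟩ := h e he k
    obtain ⟨C, hC, hb⟩ := hm.bound
    refine ⟨Real.sqrt C, Real.sqrt_nonneg _, fun n hn hneg => ?_⟩
    have h0 : 0 < 1 / (2 * ‖n‖) := by positivity
    have h1 : 1 / (2 * ‖n‖) ≤ 1 := by
      rw [div_le_one (by positivity)]; linarith
    have h2 := (norm_cf_le_of_dl_iterate hu hneg m).trans (hb _ h0 h1)
    have h3 : ((1 / (2 * ‖n‖)) ^ ρ) ^ k ≤ (1 / (2 * ‖n‖)) ^ K := by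
      rw [← Real.rpow_natCast, ← Real.rpow_mul h0.le, ← Real.rpow_natCast]
      exact Real.rpow_le_rpow_of_exponent_ge h0 h1 (by linarith)
    have h4 : ‖cf u n‖ ≤ Real.sqrt C * (1 / (2 * ‖n‖)) ^ K := by
      refine le_of_sq_le_sq ?_ (by positivity)
      rw [mul_pow, Real.sq_sqrt hC]
      exact h2.trans (by gcongr)
    have h5 : (1 / (2 * ‖n‖)) ^ K * (1 + ‖n‖) ^ K ≤ 1 := by
      rw [← mul_pow]
      refine pow_le_one₀ (by positivity) ?_
      rw [one_div_mul_eq_div, div_le_one (by positivity)]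
      linarith
    calc ‖cf u n‖ * (1 + ‖n‖) ^ K
        ≤ Real.sqrt C * (1 / (2 * ‖n‖)) ^ K * (1 + ‖n‖) ^ K := by gcongr
      _ = Real.sqrt C * ((1 / (2 * ‖n‖)) ^ K * (1 + ‖n‖) ^ K) := by ring
      _ ≤ Real.sqrt C := mul_le_of_le_one_right (Real.sqrt_nonneg _) h5
  obtain ⟨C1, p1, b1⟩ := hdir vx vx_mem_dirs
  obtain ⟨C2, p2, b2⟩ := hdir vy vy_mem_dirs
  obtain ⟨C3, p3, b3⟩ := hdir vt vt_mem_dirs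
  refine ⟨C1 + C2 + C3 + ‖cf u 0‖, by positivity, fun n => ?_⟩
  have p4 := norm_nonneg (cf u 0)
  by_cases hn : n = 0
  · simp only [hn, norm_zero, add_zero, one_pow, mul_one]
    linarith
  · obtain ⟨e, he, h1, h2⟩ := exists_dir_mFourier_eq hn
    rcases he with rfl | rfl | rfl
    · linarith [b1 n h1 h2]
    · linarith [b2 n h1 h2]
    · linarith [b3 n h1 h2]

lemma summable_inv_one_add_norm_sq : Summable fun n : ℤ => ((1 + ‖n‖) ^ 2)⁻¹ := by
  refine Summable.of_norm_bounded_eventually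
    (Real.summable_one_div_int_pow (p := 2).2 (by norm_num)) ?_
  filter_upwards [(Set.finite_singleton (0 : ℤ)).compl_mem_cofinite] with n hn
  have h1 : 0 < |(n : ℝ)| := abs_pos.2 (by exact_mod_cast hn)
  rw [Real.norm_of_nonneg (by positivity), one_div, Int.norm_eq_abs, ← sq_abs (n : ℝ)]
  gcongr
  linarith

lemma summable_inv_one_add_norm_pow_six :
    Summable fun n : Fin 3 → ℤ => ((1 + ‖n‖) ^ 6)⁻¹ := by
  have h1 := summable_inv_one_add_norm_sq
  have h2 := h1.mul_of_nonneg (h1.mul_of_nonneg h1 (fun n => by positivity)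
    fun n => by positivity) (fun n => by positivity) fun n => by positivity
  let φ : (Fin 3 → ℤ) → ℤ × ℤ × ℤ := fun n => (n 0, n 1, n 2)
  have hφ : Function.Injective φ := fun a b hab => by
    simp only [φ, Prod.mk.injEq] at hab
    ext i; fin_cases i
    exacts [hab.1, hab.2.1, hab.2.2]
  refine Summable.of_nonneg_of_le (fun n => by positivity) (fun n => ?_) (h2.comp_injective hφ)
  simp only [Function.comp, φ]
  rw [← mul_inv, ← mul_inv, show (1 + ‖n‖) ^ 6 = (1 + ‖n‖) ^ 2 * ((1 + ‖n‖) ^ 2 * (1 + ‖n‖) ^ 2)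
    by ring]
  gcongr <;> exact norm_le_pi_norm n _

lemma hasSum_cf (hu : PerCont u) (hs : Summable (cf u)) (p : R3) :
    HasSum (fun n => cf u n * mFourier n (toTorus p)) (u p : ℂ) := by
  let U : C(UnitAddTorus (Fin 3), ℂ) :=
    ⟨fun θ => (u (torusSec θ) : ℂ), Complex.continuous_ofReal.comp hu.continuous_torusSec⟩
  have hc : mFourierCoeff U = cf u := by
    ext n
    rfl
  have := hasSum_mFourier_series_apply_of_summable (f := U) (by rw [hc]; exact hs) (toTorus p)
  rw [hc] at this
  have h2 : U (toTorus p) = (u p : ℂ) := by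
    simp only [U, ContinuousMap.coe_mk, hu.per.apply_torusSec]
  rwa [h2] at this

/-- The linear phase of a Fourier mode. -/
def phase (n : Fin 3 → ℤ) : R3 →L[ℝ] ℝ :=
  (2 * Real.pi) • ((n 0 : ℝ) • ContinuousLinearMap.fst ℝ ℝ (ℝ × ℝ)
    + (n 1 : ℝ) • (ContinuousLinearMap.fst ℝ ℝ ℝ).comp (ContinuousLinearMap.snd ℝ ℝ (ℝ × ℝ))
    + (n 2 : ℝ) • (ContinuousLinearMap.snd ℝ ℝ ℝ).comp (ContinuousLinearMap.snd ℝ ℝ (ℝ × ℝ)))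

lemma phase_apply (n : Fin 3 → ℤ) (p : R3) :
    phase n p = 2 * Real.pi * (n 0 * p.1 + n 1 * p.2.1 + n 2 * p.2.2) := by
  simp [phase]
  ring

lemma norm_phase_le (n : Fin 3 → ℤ) : ‖phase n‖ ≤ 6 * Real.pi * (1 + ‖n‖) := by
  refine ContinuousLinearMap.opNorm_le_bound _ (by positivity) fun p => ?_
  have hn : ∀ i, |(n i : ℝ)| ≤ ‖n‖ := fun i => by
    rw [← Int.norm_eq_abs]; exact norm_le_pi_norm n i
  have h1 : |p.1| ≤ ‖p‖ := norm_fst_le p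
  have h2 : |p.2.1| ≤ ‖p‖ := (norm_fst_le p.2).trans (norm_snd_le p)
  have h3 : |p.2.2| ≤ ‖p‖ := (norm_snd_le p.2).trans (norm_snd_le p)
  rw [phase_apply, Real.norm_eq_abs, abs_mul, abs_of_pos (by positivity : 0 < 2 * Real.pi)]
  have key : |n 0 * p.1 + n 1 * p.2.1 + n 2 * p.2.2| ≤ 3 * ((1 + ‖n‖) * ‖p‖) := by
    have t : ∀ (i : Fin 3) (x : ℝ), |x| ≤ ‖p‖ → |n i * x| ≤ (1 + ‖n‖) * ‖p‖ := fun i x hx => by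
      rw [abs_mul]
      exact mul_le_mul (by linarith [hn i]) hx (abs_nonneg _) (by positivity)
    refine (abs_add_le _ _).trans ?_
    linarith [abs_add_le (n 0 * p.1) (n 1 * p.2.1), t 0 _ h1, t 1 _ h2, t 2 _ h3]
  calc 2 * Real.pi * |n 0 * p.1 + n 1 * p.2.1 + n 2 * p.2.2|
      ≤ 2 * Real.pi * (3 * ((1 + ‖n‖) * ‖p‖)) := by gcongr
    _ = 6 * Real.pi * (1 + ‖n‖) * ‖p‖ := by ring

lemma contDiff_cexp_mul_I {N : WithTop ℕ∞} :
    ContDiff ℝ N fun r : ℝ => Complex.exp (r * Complex.I) :=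
  (Complex.ofRealCLM.contDiff.mul contDiff_const).cexp

lemma iteratedDeriv_cexp_mul_I (k : ℕ) :
    iteratedDeriv k (fun r : ℝ => Complex.exp (r * Complex.I))
      = fun r : ℝ => Complex.I ^ k * Complex.exp (r * Complex.I) := by
  induction k with
  | zero => simp
  | succ k ih =>
    rw [iteratedDeriv_succ, ih]
    ext r
    have h : HasDerivAt (fun r : ℝ => (r : ℂ) * Complex.I) Complex.I r := by
      simpa using (Complex.ofRealCLM.hasDerivAt (x := r)).mul_const Complex.I
    rw [(h.cexp.const_mul _).deriv]
    ring

lemma norm_iteratedFDeriv_mode_le (k : ℕ) (n : Fin 3 → ℤ) (p : R3) :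
    ‖iteratedFDeriv ℝ k (fun p : R3 => Complex.exp (phase n p * Complex.I)) p‖
      ≤ (6 * Real.pi * (1 + ‖n‖)) ^ k := by
  have h := (phase n).iteratedFDeriv_comp_right (contDiff_cexp_mul_I (N := k)) p le_rfl
  have h2 : (fun p : R3 => Complex.exp (phase n p * Complex.I))
      = (fun r : ℝ => Complex.exp (r * Complex.I)) ∘ phase n := rfl
  rw [h2, h]
  refine (ContinuousMultilinearMap.norm_compContinuousLinearMap_le _ _).trans ?_
  rw [norm_iteratedFDeriv_eq_norm_iteratedDeriv, iteratedDeriv_cexp_mul_I]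
  simp only [norm_mul, norm_pow, Complex.norm_I, one_pow, Complex.norm_exp_ofReal_mul_I, one_mul,
    Finset.prod_const, Finset.card_univ, Fintype.card_fin]
  exact pow_le_pow_left₀ (norm_nonneg _) (norm_phase_le n) k

lemma contDiff_of_cf_decay (hu : PerCont u)
    (h : ∀ K : ℕ, ∃ C, 0 ≤ C ∧ ∀ n, ‖cf u n‖ * (1 + ‖n‖) ^ K ≤ C) :
    ContDiff ℝ (⊤ : ℕ∞) u := by
  have hsum : ∀ k : ℕ, Summable fun n => ‖cf u n‖ * (6 * Real.pi * (1 + ‖n‖)) ^ k := fun k => by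
    obtain ⟨C, hC, hb⟩ := h (k + 6)
    refine Summable.of_nonneg_of_le (fun n => by positivity) (fun n => ?_)
      (summable_inv_one_add_norm_pow_six.mul_left ((6 * Real.pi) ^ k * C))
    rw [← div_eq_mul_inv, le_div_iff₀ (by positivity)]
    calc ‖cf u n‖ * (6 * Real.pi * (1 + ‖n‖)) ^ k * (1 + ‖n‖) ^ 6
        = (6 * Real.pi) ^ k * (‖cf u n‖ * (1 + ‖n‖) ^ (k + 6)) := by
          rw [mul_pow (6 * Real.pi), pow_add]; ring
      _ ≤ (6 * Real.pi) ^ k * C := by gcongr; exact hb n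
  have hs : Summable (cf u) := Summable.of_norm (by simpa using hsum 0)
  have hmode : ∀ n, ContDiff ℝ (⊤ : ℕ∞) fun p : R3 => Complex.exp (phase n p * Complex.I) :=
    fun n => contDiff_cexp_mul_I.comp (phase n).contDiff
  have hU : ContDiff ℝ (⊤ : ℕ∞)
      fun p : R3 => ∑' n, cf u n * Complex.exp (phase n p * Complex.I) := by
    refine contDiff_tsum (fun n => contDiff_const.mul (hmode n)) (fun k _ => hsum k)
      fun k n p _ => ?_
    have h1 : (fun p : R3 => cf u n * Complex.exp (phase n p * Complex.I))
        = cf u n • fun p : R3 => Complex.exp (phase n p * Complex.I) := rfl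
    rw [h1, iteratedFDeriv_const_smul_apply
      ((hmode n).of_le (by exact_mod_cast le_top)).contDiffAt, norm_smul]
    exact mul_le_mul_of_nonneg_left (norm_iteratedFDeriv_mode_le k n p) (norm_nonneg _)
  have hre : u = fun p => Complex.reCLM (∑' n, cf u n * Complex.exp (phase n p * Complex.I)) := by
    ext p
    have := (hasSum_cf hu hs p).tsum_eq
    simp only [mFourier_toTorus, ← phase_apply] at this
    rw [this]
    simp
  rw [hre]
  exact Complex.reCLM.contDiff.comp hU

end Fourier

lemma enorm3_smul_of_mem_dirs {e : R3} (he : e ∈ dirs) {s : ℝ} (hs : 0 ≤ s) :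
    enorm3 (s • e) = s := by
  rcases he with rfl | rfl | rfl <;> simp [enorm3, vx, vy, vt, Real.sqrt_sq hs]

/-- Regularity: a `1`-periodic zero-mean `C²` solution of the
reduced Calabi–Yau equation whose second derivatives are `ρ`-Hölder continuous
(for some `ρ > 0`) is `C^∞`, provided `F` is `C^∞` and `1`-periodic. -/
theorem stmt15 (ρ : ℝ) (hρ : 0 < ρ) (F u : R3 → ℝ)
    (hF : ContDiff ℝ (⊤ : ℕ∞) F) (hFper : Periodic3 F)
    (hu : ContDiff ℝ 2 u) (huper : Periodic3 u) (humean : ZeroMean u)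
    (hHolder : ∀ e ∈ ({vx, vy, vt} : Set R3), ∀ e' ∈ ({vx, vy, vt} : Set R3),
      ∃ C : ℝ, ∀ q h : R3, 0 < enorm3 h → enorm3 h ≤ 1 →
        |pd e (pd e' u) (q + h) - pd e (pd e' u) q| ≤ C * enorm3 h ^ ρ)
    (hsol : CYeq F u) :
    ContDiff ℝ (⊤ : ℕ∞) u := by
  have hu' : PerDiff 2 u := ⟨huper, hu⟩
  have hG : ∀ n, PerDiff n (fun p => Real.exp (F p)) := fun n =>
    ⟨fun p => by
      obtain ⟨h1, h2, h3⟩ := hFper p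
      exact ⟨congrArg Real.exp h1, congrArg Real.exp h2, congrArg Real.exp h3⟩,
      (hF.of_le (by exact_mod_cast le_top)).exp⟩
  have hρ' : 0 < min ρ 1 := lt_min hρ one_pos
  have hH : ∀ e ∈ dirs, ∀ i ∈ dirs, ∀ j ∈ dirs,
      SupO (min ρ 1) 1 (fun s => dl (s • e) (pd j (pd i u))) := by
    intro e he i hi j hj
    refine ⟨fun s => ((hu'.pd i).pd j).perCont.dl _, ?_⟩
    obtain ⟨C, hC⟩ := hHolder j hj i hi
    refine ⟨|C|, abs_nonneg C, fun s hs hs1 p => ?_⟩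
    have hn := enorm3_smul_of_mem_dirs he hs.le
    have h := hC p (s • e) (by rwa [hn]) (by rwa [hn])
    rw [hn] at h
    calc |dl (s • e) (pd j (pd i u)) p| ≤ C * s ^ ρ := h
      _ ≤ |C| * s ^ ρ := by gcongr; exact le_abs_self C
      _ ≤ |C| * (s ^ min ρ 1) ^ 1 := by
        rw [pow_one]
        gcongr ?_ * ?_
        exact Real.rpow_le_rpow_of_exponent_ge hs hs1 (min_le_left _ _)
  exact contDiff_of_cf_decay hu'.perCont
    (exists_norm_cf_mul_le hρ' hu'.perCont fun e he k =>
      ⟨2 ^ k, (smallDiff_of_solution (min_le_right _ _) hu' hG (fun p => Real.exp_pos _) hsol hH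
        he k).zero _ le_rfl⟩)

end
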